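/- arXiv:1301.0792 — 2 statements merged into one kernel-verified Lean document; each statement's English description precedes it below -/
import Mathlib

section
/- Let F be a perfectoid field with respect to the prime p. Let E be a field equipped with a multiplicative nonarchimedean norm under which E is complete, together with a ring homomorphism F → E that is isometric and makes E a finite-dimensional F-vector space. Then E is again a perfectoid field: E has characteristic 0, ‖p‖_E < 1, the norm on E is not discretely valued (for every ε > 0 there exists x ∈ E, x ≠ 0, with 1 < ‖x‖ < 1 + ε), and for every x ∈ E with ‖x‖ ≤ 1 there exists y ∈ E with ‖x − y^p‖ ≤ ‖p‖_E. -/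
/-- A multiplicative nonarchimedean norm on a field `F`, with respect to which `F` is
complete (every Cauchy sequence converges). -/
structure CompleteMulNorm (F : Type*) [Field F] where
  nrm : F → ℝ
  nonneg : ∀ x, 0 ≤ nrm x
  eq_zero_iff : ∀ x, nrm x = 0 ↔ x = 0
  mul : ∀ x y, nrm (x * y) = nrm x * nrm y
  nonarch : ∀ x y, nrm (x + y) ≤ max (nrm x) (nrm y)
  complete : ∀ u : ℕ → F,
    (∀ ε : ℝ, 0 < ε → ∃ N : ℕ, ∀ m ≥ N, ∀ n ≥ N, nrm (u m - u n) < ε) →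
    ∃ x : F, ∀ ε : ℝ, 0 < ε → ∃ N : ℕ, ∀ n ≥ N, nrm (u n - x) < ε

/-- The field `F`, equipped with a complete multiplicative nonarchimedean norm, is a
perfectoid field with respect to the prime `p`: it has characteristic `0`, `‖p‖ < 1`,
the norm is not discretely valued, and Frobenius is surjective on `𝔬_F/(p)`. -/
def CompleteMulNorm.IsPerfectoid {F : Type*} [Field F] (p : ℕ) (ν : CompleteMulNorm F) : Prop :=
  CharZero F ∧
  ν.nrm (p : F) < 1 ∧
  (∀ ε : ℝ, 0 < ε → ∃ x : F, x ≠ 0 ∧ 1 < ν.nrm x ∧ ν.nrm x < 1 + ε) ∧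
  ∀ x : F, ν.nrm x ≤ 1 → ∃ y : F, ν.nrm (x - y ^ p) ≤ ν.nrm (p : F)

namespace UltrametricField

open Polynomial IntermediateField

section Norm

variable {A : Type*} [NormedField A] [IsUltrametricDist A]

/-- The elements of norm at most one lying in a given subring. -/
def integers (S : Subring A) : Subring A where
  carrier := {x | x ∈ S ∧ ‖x‖ ≤ 1}
  mul_mem' ha hb := ⟨mul_mem ha.1 hb.1, by
    rw [norm_mul]; exact mul_le_one₀ ha.2 (norm_nonneg _) hb.2⟩
  one_mem' := ⟨one_mem _, by simp⟩
  add_mem' ha hb := ⟨add_mem ha.1 hb.1, (IsUltrametricDist.norm_add_le_max _ _).trans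
    (max_le ha.2 hb.2)⟩
  zero_mem' := ⟨zero_mem _, by simp⟩
  neg_mem' ha := ⟨neg_mem ha.1, by simpa using ha.2⟩

lemma norm_sub_le_max' (a b : A) : ‖a - b‖ ≤ max ‖a‖ ‖b‖ := by
  simpa [sub_eq_add_neg] using IsUltrametricDist.norm_add_le_max a (-b)

lemma norm_add_pow_prime_sub_le {p : ℕ} (hp : p.Prime) {a b : A} (ha : ‖a‖ ≤ 1) (hb : ‖b‖ ≤ 1) :
    ‖(a + b) ^ p - (a ^ p + b ^ p)‖ ≤ ‖(p : A)‖ * ‖b‖ := by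
  obtain ⟨r, hr⟩ := (Commute.all (⟨a, trivial, ha⟩ : integers (⊤ : Subring A))
    ⟨b, trivial, hb⟩).exists_add_pow_prime_eq hp
  have hr' : (a + b) ^ p - (a ^ p + b ^ p) = p * a * b * r.1 := by
    have := congrArg Subtype.val hr
    simp only [Subring.coe_pow, Subring.coe_add, Subring.coe_mul, Subring.coe_natCast] at this
    rw [this]; ring
  rw [hr', norm_mul, norm_mul, norm_mul]
  have h2 := r.2.2
  calc ‖(p : A)‖ * ‖a‖ * ‖b‖ * ‖(r : A)‖ ≤ ‖(p : A)‖ * 1 * ‖b‖ * 1 := by gcongr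
    _ = _ := by ring

lemma norm_pow_sub_pow_le {p : ℕ} (hp : p.Prime) {a b : A} (ha : ‖a‖ ≤ 1) (hb : ‖b‖ ≤ 1) :
    ‖b ^ p - a ^ p‖ ≤ max (‖b - a‖ ^ p) (‖(p : A)‖ * ‖b - a‖) := by
  have hba : ‖b - a‖ ≤ 1 := (norm_sub_le_max' b a).trans (max_le hb ha)
  have h := norm_add_pow_prime_sub_le hp ha hba
  have : b ^ p - a ^ p = (b - a) ^ p + ((a + (b - a)) ^ p - (a ^ p + (b - a) ^ p)) := by ring
  rw [this]
  refine (IsUltrametricDist.norm_add_le_max _ _).trans ?_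
  rw [norm_pow]
  exact max_le_max le_rfl h

lemma norm_sub_pow_le {p : ℕ} (hp : p.Prime) {a b : A} (ha : ‖a‖ ≤ 1) (hb : ‖b‖ ≤ 1) :
    ‖b - a‖ ^ p ≤ max ‖b ^ p - a ^ p‖ (‖(p : A)‖ * ‖b - a‖) := by
  have hba : ‖b - a‖ ≤ 1 := (norm_sub_le_max' b a).trans (max_le hb ha)
  have h := norm_add_pow_prime_sub_le hp ha hba
  have : (b - a) ^ p = (b ^ p - a ^ p) - ((a + (b - a)) ^ p - (a ^ p + (b - a) ^ p)) := by ring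
  rw [← norm_pow, this]
  exact (norm_sub_le_max' _ _).trans (max_le_max le_rfl h)

lemma norm_sum_pow_prime_sub_le {p : ℕ} (hp : p.Prime) {ι : Type*} (s : Finset ι) (f : ι → A)
    (hf : ∀ i ∈ s, ‖f i‖ ≤ 1) :
    ‖(∑ i ∈ s, f i) ^ p - ∑ i ∈ s, f i ^ p‖ ≤ ‖(p : A)‖ := by
  classical
  induction s using Finset.induction_on with
  | empty => simp [hp.ne_zero]
  | insert a s ha ih =>
    rw [Finset.sum_insert ha, Finset.sum_insert ha]
    have hs : ‖∑ i ∈ s, f i‖ ≤ 1 :=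
      IsUltrametricDist.norm_sum_le_of_forall_le_of_nonneg zero_le_one
        fun i hi => hf i (Finset.mem_insert_of_mem hi)
    have h1 := norm_add_pow_prime_sub_le hp (hf a (Finset.mem_insert_self _ _)) hs
    have h2 := ih fun i hi => hf i (Finset.mem_insert_of_mem hi)
    have : (f a + ∑ i ∈ s, f i) ^ p - (f a ^ p + ∑ i ∈ s, f i ^ p) =
      ((f a + ∑ i ∈ s, f i) ^ p - (f a ^ p + (∑ i ∈ s, f i) ^ p)) +
        ((∑ i ∈ s, f i) ^ p - ∑ i ∈ s, f i ^ p) := by ring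
    rw [this]
    refine (IsUltrametricDist.norm_add_le_max _ _).trans (max_le (h1.trans ?_) h2)
    exact mul_le_of_le_one_right (norm_nonneg _) hs

lemma norm_coeff_mul_le {f g : A[X]} {b c : ℝ} (hb : 0 ≤ b) (hc : 0 ≤ c)
    (hf : ∀ i, ‖f.coeff i‖ ≤ b) (hg : ∀ i, ‖g.coeff i‖ ≤ c) (i : ℕ) :
    ‖(f * g).coeff i‖ ≤ b * c := by
  rw [coeff_mul]
  refine IsUltrametricDist.norm_sum_le_of_forall_le_of_nonneg (by positivity) fun x _ => ?_
  rw [norm_mul]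
  exact mul_le_mul (hf _) (hg _) (norm_nonneg _) hb

lemma norm_coeff_prod_le {ι : Type*} (s : Finset ι) (f : ι → A[X]) {b : ℝ} (hb : 0 ≤ b)
    (hf : ∀ j ∈ s, ∀ i, ‖(f j).coeff i‖ ≤ b) (i : ℕ) :
    ‖(∏ j ∈ s, f j).coeff i‖ ≤ b ^ s.card := by
  classical
  induction s using Finset.induction_on generalizing i with
  | empty => rw [Finset.prod_empty, coeff_one]; split_ifs <;> simp
  | insert a s ha ih =>
    rw [Finset.prod_insert ha, Finset.card_insert_of_notMem ha, pow_succ']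
    exact norm_coeff_mul_le hb (by positivity) (hf a (Finset.mem_insert_self _ _))
      (fun i => ih (fun j hj => hf j (Finset.mem_insert_of_mem hj)) i) i

lemma norm_coeff_X_sub_C_le {a : A} (ha : ‖a‖ ≤ 1) (i : ℕ) : ‖(X - C a).coeff i‖ ≤ 1 := by
  rw [coeff_sub, coeff_X, coeff_C]
  refine (norm_sub_le_max' _ _).trans (max_le ?_ ?_) <;> split_ifs <;> simp [ha]

/-- A polynomial that is small on a set of well separated points, of cardinality larger than its
degree, has small coefficients. -/
lemma norm_coeff_le_of_separated {s : Finset A} {η r : ℝ} {N : ℕ} {h : A[X]} (hη : 0 < η)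
    (hη1 : η ≤ 1) (hN : s.card ≤ N) (hs : ∀ a ∈ s, ‖a‖ ≤ 1)
    (hsep : ∀ a ∈ s, ∀ b ∈ s, a ≠ b → η ≤ ‖a - b‖) (hdeg : h.degree < s.card)
    (hr : 0 ≤ r) (hh : ∀ a ∈ s, ‖h.eval a‖ ≤ r) (i : ℕ) :
    ‖h.coeff i‖ ≤ r * (η⁻¹) ^ N := by
  classical
  have hη' : 1 ≤ η⁻¹ := (one_le_inv₀ hη).2 hη1
  rw [Lagrange.eq_interpolate (s := s) (v := id) (Set.injOn_id _) hdeg, Lagrange.interpolate_apply,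
    finsetSum_coeff]
  refine IsUltrametricDist.norm_sum_le_of_forall_le_of_nonneg (by positivity) fun a ha => ?_
  rw [coeff_C_mul, norm_mul]
  refine mul_le_mul (hh a ha) ?_ (norm_nonneg _) hr
  refine (norm_coeff_prod_le _ _ (b := η⁻¹) (by positivity) (fun b hb i => ?_) i).trans
    (pow_le_pow_right₀ hη' ((Finset.card_erase_le).trans hN))
  obtain ⟨hba, hb⟩ := Finset.mem_erase.1 hb
  rw [Lagrange.basisDivisor, coeff_C_mul, norm_mul, norm_inv]
  have h1 : ‖(id a - id b : A)‖⁻¹ ≤ η⁻¹ := inv_anti₀ hη (hsep a ha b hb hba.symm)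
  simpa using mul_le_mul h1 (norm_coeff_X_sub_C_le (hs b hb) i) (norm_nonneg _) (by positivity)

lemma norm_le_one_of_monic {S : Subring A} {Q : (integers S)[X]} (hQ : Q.Monic) {x : A}
    (hx : aeval x Q = 0) : ‖x‖ ≤ 1 := by
  by_contra! h
  have hx0 : 0 < ‖x‖ := by linarith
  rw [hQ.as_sum, map_add, map_pow, aeval_X] at hx
  have h1 : ‖x‖ ^ Q.natDegree = ‖∑ i ∈ Finset.range Q.natDegree, (Q.coeff i : A) * x ^ i‖ := by
    rw [← norm_pow, eq_neg_of_add_eq_zero_left hx, norm_neg]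
    simp only [map_sum, map_mul, map_pow, aeval_C, aeval_X]
    rfl
  rcases Nat.eq_zero_or_pos Q.natDegree with h0 | h0
  · rw [h0] at h1; simp at h1
  have h2 : ‖∑ i ∈ Finset.range Q.natDegree, (Q.coeff i : A) * x ^ i‖ ≤
      ‖x‖ ^ (Q.natDegree - 1) := by
    refine IsUltrametricDist.norm_sum_le_of_forall_le_of_nonneg (by positivity) fun i hi => ?_
    rw [norm_mul, norm_pow]
    have hi' : i ≤ Q.natDegree - 1 := by have := Finset.mem_range.1 hi; omega
    calc _ ≤ 1 * ‖x‖ ^ i := by gcongr; exact (Q.coeff i).2.2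
      _ ≤ _ := by rw [one_mul]; exact pow_le_pow_right₀ h.le hi'
  have h3 : ‖x‖ ^ (Q.natDegree - 1) < ‖x‖ ^ Q.natDegree := pow_lt_pow_right₀ h (by omega)
  linarith

lemma norm_aeval_le_one {S : Subring A} (Q : (integers S)[X]) {x : A} (hx : ‖x‖ ≤ 1) :
    ‖aeval x Q‖ ≤ 1 := by
  rw [aeval_eq_sum_range]
  refine IsUltrametricDist.norm_sum_le_of_forall_le_of_nonneg zero_le_one fun i _ => ?_
  rw [Algebra.smul_def, norm_mul, norm_pow]
  exact mul_le_one₀ (Q.coeff i).2.2 (by positivity) (pow_le_one₀ (norm_nonneg _) hx)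

lemma norm_aeval_sub_le {S : Subring A} (Q : (integers S)[X]) {x y : A} (hx : ‖x‖ ≤ 1)
    (hy : ‖y‖ ≤ 1) : ‖aeval x Q - aeval y Q‖ ≤ ‖x - y‖ := by
  let j : integers S →+* integers (⊤ : Subring A) := Subring.inclusion fun z hz => ⟨trivial, hz.2⟩
  let x' : integers (⊤ : Subring A) := ⟨x, trivial, hx⟩
  let y' : integers (⊤ : Subring A) := ⟨y, trivial, hy⟩
  have key : ∀ z : integers (⊤ : Subring A), (((Q.map j).eval z : integers ⊤) : A) =
      aeval (z : A) Q := by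
    intro z
    rw [eval_map, aeval_def]
    exact hom_eval₂ Q j (integers (⊤ : Subring A)).subtype z
  obtain ⟨c, hc⟩ := sub_dvd_eval_sub x' y' (Q.map j)
  have := congrArg Subtype.val hc
  simp only [AddSubgroupClass.coe_sub, key, Subring.coe_mul] at this
  rw [this, norm_mul]
  exact mul_le_of_le_one_right (norm_nonneg _) c.2.2

end Norm

section Galois

variable {F A : Type*} [Field F] [NormedField A] [Algebra F A]

/-- `σ` fixes the intermediate field `L` pointwise. -/
def Fixes (L : IntermediateField F A) (σ : A ≃ₐ[F] A) : Prop := ∀ z ∈ L, σ z = z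

/-- The conjugates of `β` over `L` other than `β` have distance at least `η` from `β`. -/
def IsSeparated (L : IntermediateField F A) (β : A) (η : ℝ) : Prop :=
  ∀ σ : A ≃ₐ[F] A, Fixes L σ → σ β ≠ β → η ≤ ‖σ β - β‖

lemma Fixes.mono {L M : IntermediateField F A} (h : L ≤ M) {σ : A ≃ₐ[F] A} (hσ : Fixes M σ) :
    Fixes L σ := fun z hz => hσ z (h hz)

lemma IsSeparated.mono {L M : IntermediateField F A} (h : L ≤ M) {β : A} {η : ℝ}
    (hs : IsSeparated L β η) : IsSeparated M β η := fun σ hσ => hs σ (hσ.mono h)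

lemma Fixes.map_aeval {L : IntermediateField F A} {σ : A ≃ₐ[F] A} (hσ : Fixes L σ) (g : L[X])
    (x : A) : σ (aeval x g) = aeval (σ x) g := by
  rw [aeval_def, aeval_def, ← AlgEquiv.coe_ringEquiv, ← RingEquiv.coe_toRingHom, hom_eval₂]
  congr 1
  ext z
  exact hσ z z.2

variable [Algebra.IsAlgebraic F A]

lemma exists_aeval_of_mem_sup_adjoin {L : IntermediateField F A} {β y : A} (hy : y ∈ L ⊔ F⟮β⟯) :
    ∃ g : L[X], g.degree < (minpoly L β).degree ∧ aeval β g = y := by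
  have hle : L ⊔ F⟮β⟯ ≤ (L⟮β⟯).restrictScalars F := by
    refine sup_le (fun z hz => ?_) ?_
    · exact (L⟮β⟯).algebraMap_mem ⟨z, hz⟩
    · rw [adjoin_simple_le_iff]
      exact mem_adjoin_simple_self L β
  have hβ : IsIntegral L β := (Algebra.IsAlgebraic.isAlgebraic (R := F) β).isIntegral.tower_top
  have h : y ∈ L⟮β⟯.toSubalgebra := hle hy
  rw [adjoin_simple_toSubalgebra_of_isAlgebraic hβ.isAlgebraic,
    Algebra.adjoin_singleton_eq_range_aeval] at h
  obtain ⟨g, rfl⟩ := h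
  refine ⟨g %ₘ minpoly L β, degree_modByMonic_lt _ (minpoly.monic hβ), ?_⟩
  exact aeval_modByMonic_eq_self_of_root (minpoly.aeval _ _)

variable [IsAlgClosed A]

lemma exists_fixes_of_root {L : IntermediateField F A} {β s : A}
    (h : aeval s (minpoly L β) = 0) : ∃ σ : A ≃ₐ[F] A, Fixes L σ ∧ σ β = s := by
  have : Algebra.IsAlgebraic L A := Algebra.IsAlgebraic.tower_top (K := F) L
  have : IsAlgClosure L A := ⟨inferInstance, inferInstance⟩
  have : Normal L A := IsAlgClosure.normal L A
  obtain ⟨τ, hτ⟩ := minpoly.exists_algEquiv_of_root' (K := L)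
    (Algebra.IsAlgebraic.isAlgebraic (R := L) β) h
  exact ⟨τ.restrictScalars F, fun z hz => τ.commutes ⟨z, hz⟩, hτ⟩

variable [CharZero F]

lemma mem_of_fixes {L : IntermediateField F A} {x : A}
    (h : ∀ σ : A ≃ₐ[F] A, Fixes L σ → σ x = x) : x ∈ L := by
  have : IsAlgClosure F A := ⟨inferInstance, inferInstance⟩
  have : Normal F A := IsAlgClosure.normal F A
  have : IsGalois F A := ⟨⟩
  rw [← InfiniteGalois.fixedField_fixingSubgroup L, IntermediateField.mem_fixedField_iff]
  exact fun σ hσ => h σ ((mem_fixingSubgroup_iff _ _).1 hσ)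

lemma exists_finset_conjugates (L : IntermediateField F A) (β : A) :
    ∃ S : Finset A, (∀ s, s ∈ S ↔ ∃ σ : A ≃ₐ[F] A, Fixes L σ ∧ σ β = s) ∧
      S.card = (minpoly L β).natDegree ∧
      (minpoly L β).map (algebraMap L A) = ∏ s ∈ S, (X - C s) := by
  classical
  have hβ : IsIntegral L β := (Algebra.IsAlgebraic.isAlgebraic (R := F) β).isIntegral.tower_top
  have : CharZero L := charZero_of_injective_algebraMap (algebraMap F L).injective
  have hsep : ((minpoly L β).map (algebraMap L A)).Separable :=
    (minpoly.irreducible hβ).separable.map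
  have hsp := IsAlgClosed.splits ((minpoly L β).map (algebraMap L A))
  have hmon := (minpoly.monic hβ).map (algebraMap L A)
  have hval : (((minpoly L β).map (algebraMap L A)).roots.toFinset).val =
      ((minpoly L β).map (algebraMap L A)).roots := by
    rw [Multiset.toFinset_val, Multiset.dedup_eq_self.2 (nodup_roots hsep)]
  refine ⟨((minpoly L β).map (algebraMap L A)).roots.toFinset, fun s => ?_, ?_, ?_⟩
  · rw [Multiset.mem_toFinset, mem_roots hmon.ne_zero, IsRoot, eval_map_algebraMap]
    refine ⟨exists_fixes_of_root, ?_⟩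
    rintro ⟨σ, hσ, rfl⟩
    rw [← hσ.map_aeval, minpoly.aeval, map_zero]
  · rw [Finset.card_def, hval, ← hsp.natDegree_eq_card_roots, natDegree_map]
  · rw [Finset.prod, hval]
    exact hsp.eq_prod_roots_of_monic hmon

lemma natDegree_minpoly_le_of_conjugates {K L : IntermediateField F A} (hKL : K ≤ L) {β γ : A}
    (f : A → A) (h : ∀ σ : A ≃ₐ[F] A, Fixes L σ → σ γ = f (σ β)) :
    (minpoly L γ).natDegree ≤ (minpoly K β).natDegree := by
  classical
  obtain ⟨S, hS, hcS, -⟩ := exists_finset_conjugates L γ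
  obtain ⟨T, hT, hcT, -⟩ := exists_finset_conjugates K β
  rw [← hcS, ← hcT]
  refine (Finset.card_le_card (t := T.image f) fun s hs => ?_).trans Finset.card_image_le
  obtain ⟨σ, hσ, rfl⟩ := (hS s).1 hs
  exact Finset.mem_image.2 ⟨σ β, (hT _).2 ⟨σ, hσ.mono hKL, rfl⟩, (h σ hσ).symm⟩

variable [IsUltrametricDist A]

lemma norm_coeff_le_of_isSeparated (hiso : ∀ (σ : A ≃ₐ[F] A) (x : A), ‖σ x‖ = ‖x‖)
    {L : IntermediateField F A} {β : A} {η r : ℝ} {N : ℕ} (hη : 0 < η) (hη1 : η ≤ 1)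
    (hβ : ‖β‖ ≤ 1) (hs : IsSeparated L β η) (hN : (minpoly L β).natDegree ≤ N) {h : A[X]}
    (hdeg : h.degree < (minpoly L β).natDegree) (hr : 0 ≤ r)
    (hh : ∀ σ : A ≃ₐ[F] A, Fixes L σ → ‖h.eval (σ β)‖ ≤ r) (i : ℕ) :
    ‖h.coeff i‖ ≤ r * (η⁻¹) ^ N := by
  obtain ⟨S, hS, hcard, -⟩ := exists_finset_conjugates L β
  refine norm_coeff_le_of_separated (s := S) hη hη1 (hcard ▸ hN) ?_ ?_ (hcard ▸ hdeg) hr ?_ i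
  · intro a ha
    obtain ⟨σ, -, rfl⟩ := (hS a).1 ha
    rwa [hiso]
  · intro a ha b hb hab
    obtain ⟨σ, hσ, rfl⟩ := (hS a).1 ha
    obtain ⟨τ, hτ, rfl⟩ := (hS b).1 hb
    have h1 := hs (σ.trans τ.symm) (fun z hz => by
      rw [AlgEquiv.trans_apply, hσ z hz, AlgEquiv.symm_apply_eq, hτ z hz]) (fun he => hab (by
      rwa [AlgEquiv.trans_apply, AlgEquiv.symm_apply_eq] at he))
    rwa [← hiso τ, map_sub, AlgEquiv.trans_apply, AlgEquiv.apply_symm_apply] at h1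
  · intro a ha
    obtain ⟨σ, hσ, rfl⟩ := (hS a).1 ha
    exact hh σ hσ

/-- An element of `L(β)` that is almost invariant under conjugation over `L` is close to `L`,
if the conjugates of `β` over `L` are well separated. -/
lemma exists_mem_norm_sub_le (hiso : ∀ (σ : A ≃ₐ[F] A) (x : A), ‖σ x‖ = ‖x‖)
    {L : IntermediateField F A} {β : A} {η r : ℝ} {N : ℕ} (hη : 0 < η) (hη1 : η ≤ 1)
    (hβ : ‖β‖ ≤ 1) (hs : IsSeparated L β η) (hN : (minpoly L β).natDegree ≤ N) {y : A}
    (hy : y ∈ L ⊔ F⟮β⟯) (hr : 0 ≤ r)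
    (hyr : ∀ σ : A ≃ₐ[F] A, Fixes L σ → ‖σ y - y‖ ≤ r) :
    ∃ y' ∈ L, ‖y - y'‖ ≤ r * (η⁻¹) ^ N := by
  have hint : IsIntegral L β := (Algebra.IsAlgebraic.isAlgebraic (R := F) β).isIntegral.tower_top
  obtain ⟨g, -, hg⟩ := exists_aeval_of_mem_sup_adjoin hy
  set P := minpoly L β with hP
  have hn : 0 < P.natDegree := minpoly.natDegree_pos hint
  set n := P.natDegree with hn'
  set G : L[X] := (g * X ^ (n - 1)) %ₘ P
  have hG : G.degree < n := by
    rw [← degree_eq_natDegree (minpoly.ne_zero hint)]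
    exact degree_modByMonic_lt _ (minpoly.monic hint)
  have hGβ : aeval β G = y * β ^ (n - 1) := by
    have := aeval_modByMonic_eq_self_of_root (p := g * X ^ (n - 1)) (minpoly.aeval L β)
    rw [show aeval β G = _ from this]
    simp [hg]
  refine ⟨G.coeff (n - 1), (G.coeff (n - 1)).2, ?_⟩
  have hc : (C y * X ^ (n - 1) - G.map (algebraMap L A)).coeff (n - 1) =
      y - (G.coeff (n - 1) : A) := by
    rw [coeff_sub, coeff_C_mul, coeff_X_pow_self, coeff_map, mul_one]; rfl
  rw [← hc]
  refine norm_coeff_le_of_isSeparated hiso hη hη1 hβ hs hN ?_ hr ?_ _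
  · refine (degree_sub_le _ _).trans_lt (max_lt ?_ ?_)
    · refine (degree_C_mul_X_pow_le _ _).trans_lt ?_
      exact_mod_cast Nat.sub_lt hn one_pos
    · rwa [degree_map]
  · intro σ hσ
    have : (C y * X ^ (n - 1) - G.map (algebraMap L A)).eval (σ β) =
        -((σ y - y) * (σ β) ^ (n - 1)) := by
      rw [eval_sub, eval_map_algebraMap, ← hσ.map_aeval, hGβ]
      simp; ring
    rw [this, norm_neg, norm_mul, norm_pow, hiso]
    exact (mul_le_of_le_one_right (norm_nonneg _) (pow_le_one₀ (norm_nonneg _) hβ)).trans (hyr σ hσ)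

end Galois

section Real

lemma exists_lt_pow_of_lt_one {a : ℝ} (ha : a < 1) (N : ℕ) :
    ∃ c : ℝ, 0 < c ∧ c < 1 ∧ a < c ^ N := by
  have h1 : ∀ᶠ c : ℝ in nhdsWithin 1 (Set.Iio 1), a < c ^ N := by
    have h : Filter.Tendsto (fun c : ℝ => c ^ N) (nhds 1) (nhds (1 ^ N)) :=
      (continuous_pow N).tendsto 1
    rw [one_pow] at h
    exact (h.mono_left nhdsWithin_le_nhds).eventually_const_lt ha
  have h2 : ∀ᶠ c : ℝ in nhdsWithin 1 (Set.Iio 1), 0 < c :=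
    nhdsWithin_le_nhds (lt_mem_nhds one_pos)
  obtain ⟨c, ⟨hc1, hc2⟩, hc3⟩ := ((h1.and h2).and self_mem_nhdsWithin).exists
  exact ⟨c, hc2, hc3, hc1⟩

end Real

section Frobenius

variable {F A : Type*} [Field F] [NormedField A] [Algebra F A]

/-- The norm of `A` is not discrete on `F`. -/
def IsDenselyNormed (F A : Type*) [Field F] [NormedField A] [Algebra F A] : Prop :=
  ∀ ε : ℝ, 0 < ε → ∃ x : F, 1 < ‖algebraMap F A x‖ ∧ ‖algebraMap F A x‖ < 1 + ε

/-- Every integral element of `K` is a `p`-th power of an element of `K` modulo `p`. -/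
def FrobeniusSurjective (p : ℕ) (K : IntermediateField F A) : Prop :=
  ∀ x ∈ K, ‖x‖ ≤ 1 → ∃ y ∈ K, ‖x - y ^ p‖ ≤ ‖(p : A)‖

lemma IsDenselyNormed.exists_norm_pow_mem (hd : IsDenselyNormed F A) {a b : ℝ} (ha : 0 < a)
    (hab : a < b) (k : ℕ) :
    ∃ s : F, s ≠ 0 ∧ (k ≠ 0 → a ≤ ‖algebraMap F A s‖ ^ k ∧ ‖algebraMap F A s‖ ^ k ≤ b) := by
  rcases eq_or_ne k 0 with rfl | hk
  · exact ⟨1, one_ne_zero, fun h => absurd rfl h⟩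
  have hb : 0 < b := ha.trans hab
  obtain ⟨c, hc0, hc1, hc⟩ := exists_lt_pow_of_lt_one ((div_lt_one hb).2 hab) k
  obtain ⟨x, hx1, hx2⟩ := hd (c⁻¹ - 1) (by linarith [(one_lt_inv₀ hc0).2 hc1])
  set y := ‖algebraMap F A x‖ ^ k with hy
  have hy1 : 1 < y := one_lt_pow₀ hx1 hk
  have hy2 : y < b / a := by
    have : y < (c⁻¹) ^ k := pow_lt_pow_left₀ (by linarith) (norm_nonneg _) hk
    refine this.trans ?_
    rw [inv_pow, inv_lt_comm₀ (by positivity) (by positivity), inv_div]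
    exact hc
  obtain ⟨m, hm1, hm2⟩ := exists_mem_Ioc_zpow hb hy1
  have hx0 : x ≠ 0 := by
    rintro rfl
    norm_num at hx1
  have hs : ‖algebraMap F A (x ^ m)‖ ^ k = y ^ m := by
    rw [map_zpow₀, norm_zpow, hy, ← zpow_natCast, ← zpow_natCast, ← zpow_mul, ← zpow_mul, mul_comm]
  refine ⟨x ^ m, zpow_ne_zero _ hx0, fun _ => ?_⟩
  rw [hs]
  refine ⟨?_, hm1.le⟩
  rw [zpow_add_one₀ (by linarith)] at hm2
  rw [lt_div_iff₀ ha] at hy2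
  have h0 : 0 < y ^ m := zpow_pos (by linarith) _
  by_contra! h
  nlinarith

variable [IsUltrametricDist A]

lemma norm_le_one_of_norm_sub_pow_le {p : ℕ} (hp : p.Prime) {x y : A} (hx : ‖x‖ ≤ 1)
    (h : ‖x - y ^ p‖ ≤ 1) : ‖y‖ ≤ 1 := by
  have : ‖y‖ ^ p ≤ 1 := by
    rw [← norm_pow, show y ^ p = x - (x - y ^ p) by ring]
    exact (norm_sub_le_max' _ _).trans (max_le hx h)
  exact (pow_le_one_iff_of_nonneg (norm_nonneg _) hp.ne_zero).1 this

/-- To have surjectivity of Frobenius modulo `p`, it is enough to have it modulo `c` for some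
`c` with `|p| ≤ c < |p| ^ (1 / 2)`. -/
lemma frobeniusSurjective_of_approx (hd : IsDenselyNormed F A) {p : ℕ} (hp : p.Prime)
    {K : IntermediateField F A} {c : ℝ} (hp1 : ‖(p : A)‖ < 1) (hp0 : 0 < ‖(p : A)‖)
    (hpc : ‖(p : A)‖ ≤ c) (hc : c ^ 2 < ‖(p : A)‖)
    (h : ∀ x ∈ K, ‖x‖ ≤ 1 → ∃ y ∈ K, ‖x - y ^ p‖ ≤ c) : FrobeniusSurjective p K := by
  intro x hx hx1
  have hc0 : 0 < c := hp0.trans_le hpc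
  have hc1 : c ≤ 1 := by nlinarith
  obtain ⟨y, hy, hxy⟩ := h x hx hx1
  have hcq : c < ‖(p : A)‖ / c := by rw [lt_div_iff₀ hc0]; nlinarith
  obtain ⟨s', hs0, hs⟩ := hd.exists_norm_pow_mem hc0 hcq p
  obtain ⟨hs1, hs2⟩ := hs hp.ne_zero
  set s := algebraMap F A s' with hsdef
  have hsK : s ∈ K := K.algebraMap_mem s'
  have hs0' : s ≠ 0 := by simpa [hsdef] using hs0
  have hsp : 0 < ‖s‖ ^ p := by have := norm_pos_iff.2 hs0'; positivity
  obtain ⟨w, hw, hzw⟩ := h ((x - y ^ p) / s ^ p)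
    (div_mem (sub_mem hx (pow_mem hy _)) (pow_mem hsK _)) (by
      rw [norm_div, norm_pow, div_le_one hsp]; exact hxy.trans hs1)
  have hz1 : ‖(x - y ^ p) / s ^ p‖ ≤ 1 := by
    rw [norm_div, norm_pow, div_le_one hsp]; exact hxy.trans hs1
  have hy1 := norm_le_one_of_norm_sub_pow_le hp hx1 (hxy.trans hc1)
  have hw1 := norm_le_one_of_norm_sub_pow_le hp hz1 (hzw.trans hc1)
  have hs_one : ‖s‖ ≤ 1 := by
    refine (pow_le_one_iff_of_nonneg (norm_nonneg _) hp.ne_zero).1 (hs2.trans ?_)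
    rwa [div_le_one hc0]
  have hsw : ‖s * w‖ ≤ 1 := by
    rw [norm_mul]; exact mul_le_one₀ hs_one (norm_nonneg _) hw1
  refine ⟨y + s * w, add_mem hy (mul_mem hsK hw), ?_⟩
  have : x - (y + s * w) ^ p = s ^ p * ((x - y ^ p) / s ^ p - w ^ p) -
      ((y + s * w) ^ p - (y ^ p + (s * w) ^ p)) := by
    field_simp; ring
  rw [this]
  refine (norm_sub_le_max' _ _).trans (max_le ?_ ?_)
  · rw [norm_mul, norm_pow]
    calc ‖s‖ ^ p * ‖(x - y ^ p) / s ^ p - w ^ p‖ ≤ (‖(p : A)‖ / c) * c := by gcongr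
      _ = _ := by field_simp
  · exact (norm_add_pow_prime_sub_le hp hy1 hsw).trans
      (mul_le_of_le_one_right (norm_nonneg _) hsw)

section Conjugates

variable [Algebra.IsAlgebraic F A] [IsAlgClosed A] [CharZero F]

lemma FrobeniusSurjective.sup_adjoin (hiso : ∀ (σ : A ≃ₐ[F] A) (x : A), ‖σ x‖ = ‖x‖)
    (hd : IsDenselyNormed F A) {p : ℕ} (hp : p.Prime) (hp1 : ‖(p : A)‖ < 1)
    (hp0 : 0 < ‖(p : A)‖) {K : IntermediateField F A} (hK : FrobeniusSurjective p K) {β : A}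
    {η B : ℝ} {N : ℕ} (hη : 0 < η) (hη1 : η ≤ 1) (hβ : ‖β‖ ≤ 1) (hs : IsSeparated K β η)
    (hN : (minpoly K β).natDegree ≤ N) (hηp : ‖(p : A)‖ < η ^ p) (hB1 : 1 ≤ B)
    (hηB : ((η ^ p)⁻¹) ^ N < B) (hB : B ^ 2 * ‖(p : A)‖ < 1) :
    FrobeniusSurjective p (K ⊔ F⟮β⟯) := by
  refine frobeniusSurjective_of_approx hd hp (c := B * ‖(p : A)‖) hp1 hp0
    (le_mul_of_one_le_left hp0.le hB1) (by nlinarith) fun x hx hx1 => ?_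
  have key : ∀ σ : A ≃ₐ[F] A, Fixes K σ → σ β ≠ β → η ^ p ≤ ‖σ (β ^ p) - β ^ p‖ := by
    intro σ hσ hne
    have h1 := hs σ hσ hne
    have hσβ : ‖σ β‖ ≤ 1 := by rwa [hiso]
    have h3 : ‖σ β - β‖ ≤ 1 := (norm_sub_le_max' _ _).trans (max_le hσβ hβ)
    have h4 : η ^ p ≤ ‖σ β - β‖ ^ p := by gcongr
    rw [map_pow]
    rcases le_max_iff.1 (norm_sub_pow_le hp hβ hσβ) with h | h
    · exact h4.trans h
    · have : ‖(p : A)‖ * ‖σ β - β‖ ≤ ‖(p : A)‖ := mul_le_of_le_one_right hp0.le h3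
      linarith
  have hsγ : IsSeparated K (β ^ p) (η ^ p) := fun σ hσ hne =>
    key σ hσ fun h => hne (by rw [map_pow, h])
  have hβγ : β ∈ K ⊔ F⟮β ^ p⟯ := by
    refine mem_of_fixes fun σ hσ => ?_
    by_contra hne
    have h1 := key σ (hσ.mono le_sup_left) hne
    rw [hσ _ (le_sup_right (a := K) (mem_adjoin_simple_self F (β ^ p))), sub_self, norm_zero] at h1
    have : 0 < η ^ p := by positivity
    linarith
  have hxγ : x ∈ K ⊔ F⟮β ^ p⟯ :=
    (sup_le le_sup_left (adjoin_simple_le_iff.2 hβγ) : K ⊔ F⟮β⟯ ≤ K ⊔ F⟮β ^ p⟯) hx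
  have hNγ : (minpoly K (β ^ p)).natDegree ≤ N :=
    (natDegree_minpoly_le_of_conjugates le_rfl (· ^ p) fun σ _ => map_pow σ β p).trans hN
  have hγ1 : ‖β ^ p‖ ≤ 1 := by rw [norm_pow]; exact pow_le_one₀ (norm_nonneg _) hβ
  obtain ⟨g, hg, rfl⟩ := exists_aeval_of_mem_sup_adjoin hxγ
  have hint : IsIntegral K (β ^ p) :=
    (Algebra.IsAlgebraic.isAlgebraic (R := F) (β ^ p)).isIntegral.tower_top
  have hηp0 : 0 < η ^ p := by positivity
  have hcoeff : ∀ i, ‖(g.coeff i : A)‖ ≤ ((η ^ p)⁻¹) ^ N := by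
    intro i
    have := norm_coeff_le_of_isSeparated hiso hηp0 (pow_le_one₀ hη.le hη1) hγ1 hsγ hNγ
      (h := g.map (algebraMap K A)) (by
        rwa [degree_map, ← degree_eq_natDegree (minpoly.ne_zero hint)]) zero_le_one
      (fun σ hσ => by rwa [eval_map_algebraMap, ← hσ.map_aeval, hiso]) i
    rwa [coeff_map, one_mul] at this
  obtain ⟨s', hs0, hs'⟩ := hd.exists_norm_pow_mem (by positivity) hηB p
  obtain ⟨hs1, hs2⟩ := hs' hp.ne_zero
  set s := algebraMap F A s' with hsdef
  have hsK : s ∈ K := K.algebraMap_mem s'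
  have hs0' : s ≠ 0 := by simpa [hsdef] using hs0
  have hsp : 0 < ‖s‖ ^ p := by have := norm_pos_iff.2 hs0'; positivity
  have hb1 : ∀ i, ‖(g.coeff i : A) / s ^ p‖ ≤ 1 := fun i => by
    rw [norm_div, norm_pow, div_le_one hsp]; exact (hcoeff i).trans hs1
  choose c hcK hc using fun i => hK ((g.coeff i : A) / s ^ p)
    (div_mem (g.coeff i).2 (pow_mem hsK _)) (hb1 i)
  have hc1 : ∀ i, ‖c i‖ ≤ 1 := fun i =>
    norm_le_one_of_norm_sub_pow_le hp (hb1 i) ((hc i).trans hp1.le)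
  set n := g.natDegree + 1
  refine ⟨s * ∑ i ∈ Finset.range n, c i * β ^ i, mul_mem (le_sup_left (a := K) hsK)
    (sum_mem fun i _ => mul_mem (le_sup_left (a := K) (hcK i))
      (pow_mem (le_sup_right (a := K) (mem_adjoin_simple_self F β)) _)), ?_⟩
  have hxe : aeval (β ^ p) g - (s * ∑ i ∈ Finset.range n, c i * β ^ i) ^ p =
      s ^ p * (∑ i ∈ Finset.range n, ((g.coeff i : A) / s ^ p - c i ^ p) * (β ^ p) ^ i -
        ((∑ i ∈ Finset.range n, c i * β ^ i) ^ p - ∑ i ∈ Finset.range n, (c i * β ^ i) ^ p)) := by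
    have e1 : aeval (β ^ p) g = s ^ p * ∑ i ∈ Finset.range n,
        ((g.coeff i : A) / s ^ p) * (β ^ p) ^ i := by
      rw [aeval_eq_sum_range, Finset.mul_sum]
      refine Finset.sum_congr rfl fun i _ => ?_
      rw [Algebra.smul_def, show algebraMap K A (g.coeff i) = (g.coeff i : A) from rfl]
      field_simp
    have e2 : ∑ i ∈ Finset.range n, ((g.coeff i : A) / s ^ p - c i ^ p) * (β ^ p) ^ i =
        ∑ i ∈ Finset.range n, ((g.coeff i : A) / s ^ p) * (β ^ p) ^ i -
          ∑ i ∈ Finset.range n, (c i * β ^ i) ^ p := by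
      rw [← Finset.sum_sub_distrib]
      refine Finset.sum_congr rfl fun i _ => ?_
      rw [mul_pow, sub_mul]; ring
    rw [e1, e2]; ring
  rw [hxe, norm_mul, norm_pow]
  refine mul_le_mul hs2 ((norm_sub_le_max' _ _).trans (max_le ?_ ?_)) (norm_nonneg _)
    (by linarith)
  · refine IsUltrametricDist.norm_sum_le_of_forall_le_of_nonneg hp0.le fun i _ => ?_
    rw [norm_mul, norm_pow]
    exact (mul_le_of_le_one_right (norm_nonneg _) (pow_le_one₀ (norm_nonneg _) hγ1)).trans (hc i)
  · refine norm_sum_pow_prime_sub_le hp _ _ fun i _ => ?_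
    rw [norm_mul, norm_pow]
    exact mul_le_one₀ (hc1 i) (by positivity) (pow_le_one₀ (norm_nonneg _) hβ)

end Conjugates

end Frobenius

section Improve

variable {F A : Type*} [Field F] [NormedField A] [IsUltrametricDist A] [Algebra F A]

/-- The integral elements of an intermediate field. -/
abbrev integralElements (K : IntermediateField F A) : Subring A := integers K.toSubalgebra.toSubring

variable {K : IntermediateField F A} {p : ℕ}

lemma FrobeniusSurjective.exists_monic_pow (hK : FrobeniusSurjective p K) (hp : p.Prime)
    (hp1 : ‖(p : A)‖ < 1) {P : (integralElements K)[X]} (hP : P.Monic) :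
    ∃ P₁ : (integralElements K)[X], P₁.Monic ∧ P₁.natDegree = P.natDegree ∧
      ∀ β : A, ‖β‖ ≤ 1 → ‖aeval (β ^ p) P - (aeval β P₁) ^ p‖ ≤ ‖(p : A)‖ := by
  have h : ∀ i, ∃ c : integralElements K, ‖(P.coeff i : A) - (c : A) ^ p‖ ≤ ‖(p : A)‖ ∧
      (P.coeff i = 1 → c = 1) := by
    intro i
    by_cases h1 : P.coeff i = 1
    · exact ⟨1, by simp [h1], fun _ => rfl⟩
    · obtain ⟨y, hy, hxy⟩ := hK (P.coeff i) (P.coeff i).2.1 (P.coeff i).2.2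
      exact ⟨⟨y, hy, norm_le_one_of_norm_sub_pow_le hp (P.coeff i).2.2 (hxy.trans hp1.le)⟩, hxy,
        fun h => absurd h h1⟩
  choose c hc hc1 using h
  set d := P.natDegree
  have hdeg : (∑ i ∈ Finset.range d, C (c i) * X ^ i).degree < (d : WithBot ℕ) := by
    rw [← mem_degreeLT]
    refine sum_mem fun i hi => mem_degreeLT.2 ((degree_C_mul_X_pow_le _ _).trans_lt ?_)
    exact_mod_cast Finset.mem_range.1 hi
  refine ⟨X ^ d + ∑ i ∈ Finset.range d, C (c i) * X ^ i, monic_X_pow_add hdeg,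
    natDegree_eq_of_degree_eq_some ?_, fun β hβ => ?_⟩
  · rw [degree_add_eq_left_of_degree_lt (by rwa [degree_X_pow]), degree_X_pow]
  have e1 : aeval β (X ^ d + ∑ i ∈ Finset.range d, C (c i) * X ^ i) =
      ∑ i ∈ Finset.range (d + 1), (c i : A) * β ^ i := by
    rw [Finset.sum_range_succ, hc1 d hP, map_add, map_pow, aeval_X, map_sum, add_comm]
    simp only [map_mul, map_pow, aeval_C, aeval_X, OneMemClass.coe_one, one_mul]
    rfl
  have e2 : aeval (β ^ p) P = ∑ i ∈ Finset.range (d + 1), (P.coeff i : A) * (β ^ p) ^ i := by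
    rw [aeval_eq_sum_range]; rfl
  have e3 : aeval (β ^ p) P - (∑ i ∈ Finset.range (d + 1), (c i : A) * β ^ i) ^ p =
      ∑ i ∈ Finset.range (d + 1), ((P.coeff i : A) - (c i : A) ^ p) * (β ^ p) ^ i -
      ((∑ i ∈ Finset.range (d + 1), (c i : A) * β ^ i) ^ p -
        ∑ i ∈ Finset.range (d + 1), ((c i : A) * β ^ i) ^ p) := by
    have : ∑ i ∈ Finset.range (d + 1), ((P.coeff i : A) - (c i : A) ^ p) * (β ^ p) ^ i =
        ∑ i ∈ Finset.range (d + 1), (P.coeff i : A) * (β ^ p) ^ i -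
          ∑ i ∈ Finset.range (d + 1), ((c i : A) * β ^ i) ^ p := by
      rw [← Finset.sum_sub_distrib]
      exact Finset.sum_congr rfl fun i _ => by ring
    rw [e2, this]; ring
  rw [e1, e3]
  refine (norm_sub_le_max' _ _).trans (max_le ?_ ?_)
  · refine IsUltrametricDist.norm_sum_le_of_forall_le_of_nonneg (norm_nonneg _) fun i _ => ?_
    rw [norm_mul, norm_pow, norm_pow]
    exact (mul_le_of_le_one_right (norm_nonneg _)
      (pow_le_one₀ (by positivity) (pow_le_one₀ (norm_nonneg _) hβ))).trans (hc i)
  · refine norm_sum_pow_prime_sub_le hp _ _ fun i _ => ?_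
    rw [norm_mul, norm_pow]
    exact mul_le_one₀ (c i).2.2 (by positivity) (pow_le_one₀ (norm_nonneg _) hβ)

lemma FrobeniusSurjective.exists_monic_pow_pow (hK : FrobeniusSurjective p K) (hp : p.Prime)
    (hp1 : ‖(p : A)‖ < 1) {P : (integralElements K)[X]} (hP : P.Monic) (k : ℕ) :
    ∃ P₁ : (integralElements K)[X], P₁.Monic ∧ P₁.natDegree = P.natDegree ∧
      ∀ β : A, ‖β‖ ≤ 1 →
        ‖aeval (β ^ p ^ k) P‖ ≤ max ‖(p : A)‖ (‖aeval β P₁‖ ^ p ^ k) := by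
  induction k with
  | zero => exact ⟨P, hP, rfl, fun β _ => by simp⟩
  | succ k ih =>
    obtain ⟨P₁, hP₁, hd, h⟩ := ih
    obtain ⟨P₂, hP₂, hd₂, h₂⟩ := hK.exists_monic_pow hp hp1 hP₁
    refine ⟨P₂, hP₂, hd₂.trans hd, fun β hβ => ?_⟩
    have hk : p ^ k ≠ 0 := pow_ne_zero _ hp.ne_zero
    have h1 := h (β ^ p) (by rw [norm_pow]; exact pow_le_one₀ (norm_nonneg _) hβ)
    rw [← pow_mul, ← pow_succ'] at h1
    refine h1.trans (max_le (le_max_left _ _) ?_)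
    have h3 : ‖aeval (β ^ p) P₁‖ ≤ max ‖(p : A)‖ (‖aeval β P₂‖ ^ p) := by
      rw [show aeval (β ^ p) P₁ =
        (aeval (β ^ p) P₁ - (aeval β P₂) ^ p) + (aeval β P₂) ^ p by ring, ← norm_pow]
      exact (IsUltrametricDist.norm_add_le_max _ _).trans (max_le_max (h₂ β hβ) le_rfl)
    rcases le_max_iff.1 h3 with h4 | h4
    · exact le_max_of_le_left ((pow_le_pow_left₀ (norm_nonneg _) h4 _).trans
        (pow_le_of_le_one (norm_nonneg _) hp1.le hk))
    · refine le_max_of_le_right ((pow_le_pow_left₀ (norm_nonneg _) h4 _).trans ?_)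
      rw [← pow_mul, ← pow_succ']

/-- The inclusion of the integral elements of an intermediate field. -/
def integralElementsInclusion (K : IntermediateField F A) : integralElements K →+* K where
  toFun x := ⟨x, x.2.1⟩
  map_one' := rfl
  map_mul' _ _ := rfl
  map_zero' := rfl
  map_add' _ _ := rfl

lemma aeval_map_integralElementsInclusion (Q : (integralElements K)[X]) (β : A) :
    aeval β (Q.map (integralElementsInclusion K)) = aeval β Q := by
  rw [aeval_def, eval₂_map]; rfl

lemma Fixes.map_aeval_integralElements {σ : A ≃ₐ[F] A} (hσ : Fixes K σ)
    (Q : (integralElements K)[X]) (β : A) :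
    σ (aeval β Q) = aeval (σ β) Q := by
  rw [← aeval_map_integralElementsInclusion, hσ.map_aeval, aeval_map_integralElementsInclusion]

lemma natDegree_minpoly_le_of_aeval_eq_zero {Q : (integralElements K)[X]} (hQ : Q.Monic) {β : A}
    (h : aeval β Q = 0) : (minpoly K β).natDegree ≤ Q.natDegree := by
  rw [← aeval_map_integralElementsInclusion] at h
  refine (natDegree_le_of_dvd (minpoly.dvd _ _ h) (hQ.map _).ne_zero).trans natDegree_map_le

lemma FrobeniusSurjective.exists_separated_roots (hK : FrobeniusSurjective p K)
    (hd : IsDenselyNormed F A) (hp : p.Prime) (hp1 : ‖(p : A)‖ < 1) (hp0 : 0 < ‖(p : A)‖)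
    {P : (integralElements K)[X]} (hP : P.Monic) (hP0 : P.natDegree ≠ 0) {η : ℝ}
    (hη : 0 < η) (hη1 : η < 1) (hpη : ‖(p : A)‖ < η) :
    ∃ (Q : (integralElements K)[X]) (k : ℕ), Q.Monic ∧ Q.natDegree = p * P.natDegree ∧
      ∀ β : A, aeval β Q = 0 → ‖β‖ ≤ 1 ∧ IsSeparated K β η ∧ ‖aeval (β ^ p ^ k) P‖ ≤ ‖(p : A)‖ := by
  obtain ⟨t', ht0, ht⟩ := hd.exists_norm_pow_mem hη (show η < (η + 1) / 2 by linarith) 1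
  obtain ⟨ht1, ht2⟩ := ht one_ne_zero
  rw [pow_one] at ht1 ht2
  set t : A := algebraMap F A t' with htdef
  have htlt : ‖t‖ < 1 := by linarith
  have htpos : 0 < ‖t‖ := by linarith
  obtain ⟨m, hm⟩ := exists_pow_lt_of_lt_one hp0 htlt
  obtain ⟨P₁, hP₁, hd₁, h₁⟩ := hK.exists_monic_pow_pow hp hp1 hP (m + 1)
  let tR : integralElements K := ⟨t, K.algebraMap_mem t', htlt.le⟩
  have hdegP : (P₁ ^ p).natDegree = p * P.natDegree := by rw [hP₁.natDegree_pow, hd₁]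
  have hdeg : (C tR * X).degree < (P₁ ^ p).degree := by
    refine (degree_C_mul_X_le _).trans_lt ?_
    rw [degree_eq_natDegree (hP₁.pow p).ne_zero, hdegP]
    have := Nat.mul_le_mul hp.two_le (Nat.one_le_iff_ne_zero.2 hP0)
    exact_mod_cast this
  refine ⟨P₁ ^ p + C tR * X, m + 1, (hP₁.pow p).add_of_left hdeg, ?_, ?_⟩
  · rw [natDegree_add_eq_left_of_degree_lt hdeg, hdegP]
  intro β hβ
  have hβ1 := norm_le_one_of_monic ((hP₁.pow p).add_of_left hdeg) hβ
  have heq : ∀ γ : A, aeval γ (P₁ ^ p + C tR * X) = (aeval γ P₁) ^ p + t * γ := by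
    intro γ
    simp only [map_add, map_pow, map_mul, aeval_C, aeval_X]
    rfl
  refine ⟨hβ1, ?_, ?_⟩
  · intro σ hσ hne
    have hσβ : aeval (σ β) (P₁ ^ p + C tR * X) = 0 := by
      rw [← hσ.map_aeval_integralElements, hβ, map_zero]
    have hσ1 := norm_le_one_of_monic ((hP₁.pow p).add_of_left hdeg) hσβ
    rw [heq] at hβ hσβ
    have hpos : 0 < ‖σ β - β‖ := norm_pos_iff.2 (sub_ne_zero.2 hne)
    have hle1 : ‖σ β - β‖ ≤ 1 := (norm_sub_le_max' _ _).trans (max_le hσ1 hβ1)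
    have h2 : ‖t‖ * ‖σ β - β‖ ≤ max (‖aeval (σ β) P₁ - aeval β P₁‖ ^ p)
        (‖(p : A)‖ * ‖aeval (σ β) P₁ - aeval β P₁‖) := by
      refine le_trans (le_of_eq ?_) (norm_pow_sub_pow_le hp (norm_aeval_le_one P₁ hβ1)
        (norm_aeval_le_one P₁ hσ1))
      rw [← norm_mul, ← norm_neg]
      congr 1
      linear_combination hβ - hσβ
    have h3 := norm_aeval_sub_le P₁ hσ1 hβ1
    rcases le_max_iff.1 h2 with h | h
    · have h4 : ‖t‖ * ‖σ β - β‖ ≤ ‖σ β - β‖ * ‖σ β - β‖ := by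
        rw [← pow_two]
        exact h.trans ((pow_le_pow_left₀ (norm_nonneg _) h3 p).trans
          (pow_le_pow_of_le_one hpos.le hle1 hp.two_le))
      exact ht1.trans (le_of_mul_le_mul_right h4 hpos)
    · have h4 : ‖t‖ * ‖σ β - β‖ ≤ ‖(p : A)‖ * ‖σ β - β‖ := h.trans (by gcongr)
      have := le_of_mul_le_mul_right h4 hpos
      linarith
  · refine (h₁ β hβ1).trans (max_le le_rfl ?_)
    rw [heq] at hβ
    have h2 : ‖aeval β P₁‖ ^ p ≤ ‖t‖ := by
      rw [← norm_pow, eq_neg_of_add_eq_zero_left hβ, norm_neg, norm_mul]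
      exact mul_le_of_le_one_right (norm_nonneg _) hβ1
    rw [pow_succ', pow_mul]
    refine (pow_le_pow_left₀ (by positivity) h2 _).trans (le_trans ?_ hm.le)
    exact pow_le_pow_of_le_one htpos.le htlt.le (Nat.lt_pow_self hp.one_lt).le

variable [Algebra.IsAlgebraic F A] [IsAlgClosed A] [CharZero F]

lemma exists_lift_minpoly (hiso : ∀ (σ : A ≃ₐ[F] A) (x : A), ‖σ x‖ = ‖x‖) {α : A}
    (hα : ‖α‖ ≤ 1) :
    ∃ P : (integralElements K)[X], P.Monic ∧ P.map (integralElementsInclusion K) = minpoly K α ∧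
      P.natDegree = (minpoly K α).natDegree := by
  have hint : IsIntegral K α := (Algebra.IsAlgebraic.isAlgebraic (R := F) α).isIntegral.tower_top
  obtain ⟨S, hS, -, hprod⟩ := exists_finset_conjugates K α
  have hlift : minpoly K α ∈ lifts (integralElementsInclusion K) := by
    rw [lifts_iff_coeff_lifts]
    intro n
    have h1 : ‖((minpoly K α).coeff n : A)‖ ≤ 1 := by
      have h2 := norm_coeff_prod_le S (fun s => X - C s) zero_le_one (fun s hs i => by
        obtain ⟨σ, -, rfl⟩ := (hS s).1 hs
        exact norm_coeff_X_sub_C_le (by rwa [hiso]) i) n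
      rwa [← hprod, coeff_map, one_pow] at h2
    exact ⟨⟨_, ((minpoly K α).coeff n).2, h1⟩, rfl⟩
  obtain ⟨P, h1, h2, h3⟩ := lifts_and_natDegree_eq_and_monic hlift (minpoly.monic hint)
  exact ⟨P, h3, h1, h2⟩

/-- Given an approximation of `α` in `K`, adjoining to `K` an element with well separated
conjugates provides a better one. -/
lemma FrobeniusSurjective.exists_better_approx (hK : FrobeniusSurjective p K)
    (hiso : ∀ (σ : A ≃ₐ[F] A) (x : A), ‖σ x‖ = ‖x‖) (hd : IsDenselyNormed F A) (hp : p.Prime)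
    (hp1 : ‖(p : A)‖ < 1) (hp0 : 0 < ‖(p : A)‖) {α : A} {D : ℕ}
    (hD : (minpoly (⊥ : IntermediateField F A) α).natDegree ≤ D) {c : ℝ} (hc0 : 0 < c)
    (hc1 : c < 1) (hpc : ‖(p : A)‖ < (c ^ 2) ^ D) {η : ℝ} (hη : 0 < η) (hη1 : η < 1)
    (hpη : ‖(p : A)‖ < η) {x : A} (hx : x ∈ K) {R : ℝ} (hR : 0 < R) (hαx : ‖α - x‖ ≤ R) :
    ∃ β : A, ‖β‖ ≤ 1 ∧ IsSeparated K β η ∧ (minpoly K β).natDegree ≤ p * D ∧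
      ∃ x' ∈ K ⊔ F⟮β⟯, ‖α - x'‖ ≤ c * R := by
  obtain ⟨s', hs0, hs⟩ := hd.exists_norm_pow_mem (a := c / R) (b := 1 / R) (by positivity)
    (by gcongr) 1
  obtain ⟨hs1, hs2⟩ := hs one_ne_zero
  rw [pow_one, div_le_iff₀ hR] at hs1
  rw [pow_one, le_div_iff₀ hR] at hs2
  set s : A := algebraMap F A s' with hsdef
  have hsK : s ∈ K := K.algebraMap_mem s'
  have hs0' : s ≠ 0 := by simpa [hsdef] using hs0
  have hspos : 0 < ‖s‖ := norm_pos_iff.2 hs0'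
  set α' := s * (α - x) with hα'
  have hα'1 : ‖α'‖ ≤ 1 := by
    rw [hα', norm_mul]
    exact (by gcongr : ‖s‖ * ‖α - x‖ ≤ ‖s‖ * R).trans hs2
  have hint : IsIntegral K α' :=
    (Algebra.IsAlgebraic.isAlgebraic (R := F) α').isIntegral.tower_top
  have hdeg : (minpoly K α').natDegree ≤ D := by
    refine (natDegree_minpoly_le_of_conjugates bot_le (fun z => s * (z - x))
      fun σ hσ => ?_).trans hD
    rw [hα', map_mul, map_sub, hσ _ hsK, hσ _ hx]
  obtain ⟨P, hP, hPmap, hPdeg⟩ := exists_lift_minpoly (K := K) hiso hα'1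
  have hP0 : P.natDegree ≠ 0 := by
    rw [hPdeg]; exact (minpoly.natDegree_pos hint).ne'
  obtain ⟨Q, k, hQ, hQdeg, hQroots⟩ := hK.exists_separated_roots hd hp hp1 hp0 hP hP0 hη hη1 hpη
  obtain ⟨β₀, hβ₀⟩ : ∃ β₀ : A, aeval β₀ Q = 0 := by
    obtain ⟨z, hz⟩ := IsAlgClosed.exists_root (Q.map (algebraMap (integralElements K) A)) (by
      rw [hQ.degree_map, degree_eq_natDegree hQ.ne_zero, hQdeg]
      exact_mod_cast mul_ne_zero hp.ne_zero hP0)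
    exact ⟨z, by rwa [IsRoot, eval_map_algebraMap] at hz⟩
  obtain ⟨S, hS, hcard, hprod⟩ := exists_finset_conjugates K α'
  obtain ⟨z, hz, hzlt⟩ : ∃ z ∈ S, ‖β₀ ^ p ^ k - z‖ < c ^ 2 := by
    by_contra! h
    have h1 := Finset.prod_le_prod (s := S) (f := fun _ => c ^ 2)
      (g := fun z => ‖β₀ ^ p ^ k - z‖) (fun _ _ => by positivity) h
    rw [Finset.prod_const, ← norm_prod] at h1
    have h2 : ∏ z ∈ S, (β₀ ^ p ^ k - z) = aeval (β₀ ^ p ^ k) P := by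
      rw [← aeval_map_integralElementsInclusion, hPmap, ← eval_map_algebraMap, hprod, eval_prod]
      simp
    have h3 : (c ^ 2) ^ D ≤ (c ^ 2) ^ S.card :=
      pow_le_pow_of_le_one (by positivity) (pow_le_one₀ hc0.le hc1.le) (hcard ▸ hdeg)
    rw [h2] at h1
    linarith [(hQroots β₀ hβ₀).2.2]
  obtain ⟨σ, hσ, rfl⟩ := (hS z).1 hz
  have hσ' : Fixes K σ.symm := fun z hz => by rw [AlgEquiv.symm_apply_eq, hσ z hz]
  have hβ : aeval (σ.symm β₀) Q = 0 := by rw [← hσ'.map_aeval_integralElements, hβ₀, map_zero]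
  obtain ⟨hβ1, hβs, -⟩ := hQroots _ hβ
  refine ⟨σ.symm β₀, hβ1, hβs, (natDegree_minpoly_le_of_aeval_eq_zero hQ hβ).trans ?_,
    x + (σ.symm β₀) ^ p ^ k / s, add_mem (le_sup_left (a := K) hx)
      (div_mem (pow_mem (le_sup_right (a := K) (mem_adjoin_simple_self F _)) _)
        (le_sup_left (a := K) hsK)), ?_⟩
  · rw [hQdeg, hPdeg]
    exact Nat.mul_le_mul_left p hdeg
  · have h1 : ‖α' - (σ.symm β₀) ^ p ^ k‖ < c ^ 2 := by
      rwa [norm_sub_rev, ← hiso σ, map_sub, map_pow, AlgEquiv.apply_symm_apply]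
    have h2 : α - (x + (σ.symm β₀) ^ p ^ k / s) = (α' - (σ.symm β₀) ^ p ^ k) / s := by
      rw [hα']; field_simp; ring
    rw [h2, norm_div, div_le_iff₀ hspos]
    nlinarith

end Improve

section Descent

variable {F A : Type*} [Field F] [NormedField A] [Algebra F A]

/-- Elements of `L ⊔ K` that are almost invariant under conjugation over `L` are close to `L`, up
to a factor `θ` that does not depend on `L`. -/
def HasDescentConstant (K : IntermediateField F A) (θ : ℝ) : Prop :=
  ∀ (L : IntermediateField F A), ∀ y ∈ L ⊔ K, ∀ r : ℝ, 0 ≤ r →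
    (∀ σ : A ≃ₐ[F] A, Fixes L σ → ‖σ y - y‖ ≤ r) → ∃ y' ∈ L, ‖y - y'‖ ≤ r * θ

lemma hasDescentConstant_bot {θ : ℝ} (hθ : 0 ≤ θ) :
    HasDescentConstant (⊥ : IntermediateField F A) θ := fun L y hy r hr _ =>
  ⟨y, by rwa [sup_bot_eq] at hy, by rw [sub_self, norm_zero]; positivity⟩

lemma HasDescentConstant.mono {K : IntermediateField F A} {θ θ' : ℝ}
    (h : HasDescentConstant K θ) (hθ : θ ≤ θ') : HasDescentConstant K θ' := by
  intro L y hy r hr hyr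
  obtain ⟨y', hy', hyy'⟩ := h L y hy r hr hyr
  exact ⟨y', hy', hyy'.trans (by gcongr)⟩

variable [IsUltrametricDist A] [Algebra.IsAlgebraic F A] [IsAlgClosed A] [CharZero F]
  {K : IntermediateField F A} {p : ℕ}

lemma HasDescentConstant.sup_adjoin {θ : ℝ} (h : HasDescentConstant K θ) (hθ : 1 ≤ θ)
    (hiso : ∀ (σ : A ≃ₐ[F] A) (x : A), ‖σ x‖ = ‖x‖) {β : A} {η : ℝ} {N : ℕ} (hη : 0 < η)
    (hη1 : η ≤ 1) (hβ : ‖β‖ ≤ 1) (hs : IsSeparated K β η) (hN : (minpoly K β).natDegree ≤ N) :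
    HasDescentConstant (K ⊔ F⟮β⟯) ((η⁻¹) ^ N * θ) := by
  intro L y hy r hr hyr
  rw [← sup_assoc] at hy
  have hη' : 1 ≤ (η⁻¹) ^ N := one_le_pow₀ ((one_le_inv₀ hη).2 hη1)
  have hLN : (minpoly ↥(L ⊔ K) β).natDegree ≤ N :=
    (natDegree_minpoly_le_of_conjugates le_sup_right id fun _ _ => rfl).trans hN
  obtain ⟨y₁, hy₁, hyy₁⟩ := exists_mem_norm_sub_le hiso hη hη1 hβ (hs.mono le_sup_right) hLN hy hr
    fun σ hσ => hyr σ (hσ.mono le_sup_left)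
  have hrr : r ≤ r * (η⁻¹) ^ N := le_mul_of_one_le_right hr hη'
  have hr₁ : 0 ≤ r * (η⁻¹) ^ N := hr.trans hrr
  obtain ⟨y', hy', hyy'⟩ := h L y₁ hy₁ (r * (η⁻¹) ^ N) hr₁ fun σ hσ => by
    rw [show σ y₁ - y₁ = (σ y - y) + ((y - y₁) - σ (y - y₁)) by rw [map_sub]; ring]
    refine (IsUltrametricDist.norm_add_le_max _ _).trans (max_le ((hyr σ hσ).trans hrr) ?_)
    refine (norm_sub_le_max' _ _).trans (max_le hyy₁ ?_)
    rwa [hiso]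
  refine ⟨y', hy', ?_⟩
  rw [show y - y' = (y - y₁) + (y₁ - y') by ring, ← mul_assoc]
  exact (IsUltrametricDist.norm_add_le_max _ _).trans
    (max_le (hyy₁.trans (le_mul_of_one_le_right hr₁ hθ)) hyy')

lemma exists_frobeniusSurjective_approx (hiso : ∀ (σ : A ≃ₐ[F] A) (x : A), ‖σ x‖ = ‖x‖)
    (hd : IsDenselyNormed F A) (hp : p.Prime) (hp1 : ‖(p : A)‖ < 1) (hp0 : 0 < ‖(p : A)‖)
    (h : FrobeniusSurjective p (⊥ : IntermediateField F A)) {α : A} {c R : ℝ} (hc0 : 0 < c)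
    (hc1 : c < 1)
    (hpc : ‖(p : A)‖ < (c ^ 2) ^ (minpoly (⊥ : IntermediateField F A) α).natDegree) (hR : 0 < R)
    (hα : ‖α‖ ≤ R) (n : ℕ) {θ : ℝ} (hθ : 1 < θ) :
    ∃ K : IntermediateField F A, FrobeniusSurjective p K ∧ HasDescentConstant K θ ∧
      ∃ x ∈ K, ‖α - x‖ ≤ c ^ n * R := by
  induction n generalizing θ with
  | zero => exact ⟨⊥, h, hasDescentConstant_bot (by linarith), 0, zero_mem _, by simpa using hα⟩
  | succ n ih =>
    set θ' := √θ
    have hθ' : 1 < θ' := Real.lt_sqrt_of_sq_lt (by simpa)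
    have hθθ : θ' * θ' = θ := Real.mul_self_sqrt (by linarith)
    obtain ⟨K, hK, hKθ, x, hx, hαx⟩ := ih hθ'
    obtain ⟨b, hb0, hb1, hb⟩ := exists_lt_pow_of_lt_one hp1 2
    set D := (minpoly (⊥ : IntermediateField F A) α).natDegree
    obtain ⟨η, hη0, hη1, hη⟩ := exists_lt_pow_of_lt_one
      (max_lt hp1 (max_lt hb1 (inv_lt_one_of_one_lt₀ hθ'))) (p * (p * D + 1))
    have hle : ∀ m, m ≤ p * (p * D + 1) → max ‖(p : A)‖ (max b θ'⁻¹) < η ^ m := fun m hm =>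
      hη.trans_le (pow_le_pow_of_le_one hη0.le hη1.le hm)
    have hm1 : 1 ≤ p * (p * D + 1) := Nat.mul_pos hp.pos (Nat.succ_pos _)
    have hm2 : p ≤ p * (p * D + 1) := Nat.le_mul_of_pos_right _ (Nat.succ_pos _)
    have hm3 : p * (p * D) ≤ p * (p * D + 1) := Nat.mul_le_mul_left _ (Nat.le_succ _)
    have hm4 : p * D ≤ p * (p * D + 1) := (Nat.le_mul_of_pos_left _ hp.pos).trans hm3
    obtain ⟨β, hβ, hs, hdeg, x', hx', hαx'⟩ := hK.exists_better_approx hiso hd hp hp1 hp0 le_rfl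
      hc0 hc1 hpc hη0 hη1 (by simpa using (le_max_left _ _).trans_lt (hle 1 hm1)) hx
      (R := c ^ n * R) (by positivity) hαx
    refine ⟨K ⊔ F⟮β⟯, hK.sup_adjoin hiso hd hp hp1 hp0 hη0 hη1.le hβ hs hdeg (B := b⁻¹)
      ((le_max_left _ _).trans_lt (hle p hm2)) ((one_le_inv₀ hb0).2 hb1.le) ?_ ?_,
      (hKθ.sup_adjoin hθ'.le hiso hη0 hη1.le hβ hs hdeg).mono ?_, x', hx', ?_⟩
    · rw [inv_pow, ← pow_mul]
      exact inv_strictAnti₀ hb0 (((le_max_left _ _).trans (le_max_right _ _)).trans_lt (hle _ hm3))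
    · rwa [inv_pow, inv_mul_lt_iff₀ (by positivity), mul_one]
    · rw [← hθθ]
      have := ((le_max_right _ _).trans (le_max_right _ _)).trans_lt (hle _ hm4)
      gcongr
      rw [inv_pow]
      exact inv_le_of_inv_le₀ (by linarith) this.le
    · rw [pow_succ', mul_assoc]
      exact hαx'

/-- Over a densely normed field on which Frobenius is surjective modulo `p`, Frobenius is
surjective modulo `p` on every finite extension. -/
theorem FrobeniusSurjective.of_finiteDimensional
    (hiso : ∀ (σ : A ≃ₐ[F] A) (x : A), ‖σ x‖ = ‖x‖)
    (hd : IsDenselyNormed F A) (hp : p.Prime) (hp1 : ‖(p : A)‖ < 1) (hp0 : 0 < ‖(p : A)‖)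
    (h : FrobeniusSurjective p (⊥ : IntermediateField F A)) (E : IntermediateField F A)
    [FiniteDimensional F E] : FrobeniusSurjective p E := by
  classical
  obtain ⟨α', hα'⟩ := Field.exists_primitive_element F E
  set α := (α' : A)
  have hEα : F⟮α⟯ = E := by
    rw [← lift_adjoin_simple, hα', lift_top]
  obtain ⟨c, hc0, hc1, hc⟩ := exists_lt_pow_of_lt_one hp1
    (2 * (minpoly (⊥ : IntermediateField F A) α).natDegree)
  rw [pow_mul] at hc
  obtain ⟨δ, hδ0, hδ⟩ : ∃ δ : ℝ, 0 < δ ∧ ∀ σ : A ≃ₐ[F] A, ‖σ α - α‖ < δ → σ α = α := by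
    obtain ⟨S, hS, -, -⟩ := exists_finset_conjugates (⊥ : IntermediateField F A) α
    have hmem : ∀ σ : A ≃ₐ[F] A, σ α ∈ S := fun σ => (hS _).2 ⟨σ, fun z hz => by
      obtain ⟨w, rfl⟩ := mem_bot.1 hz
      exact σ.commutes w, rfl⟩
    rcases (S.erase α).eq_empty_or_nonempty with he | hne
    · refine ⟨1, one_pos, fun σ _ => ?_⟩
      by_contra hσ
      exact Finset.notMem_empty _ (he ▸ Finset.mem_erase.2 ⟨hσ, hmem σ⟩)
    · obtain ⟨m, hm, hmin⟩ := (S.erase α).exists_min_image (fun s => ‖s - α‖) hne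
      refine ⟨‖m - α‖, norm_pos_iff.2 (sub_ne_zero.2 (Finset.ne_of_mem_erase hm)), fun σ hσ => ?_⟩
      by_contra hne
      exact (hmin _ (Finset.mem_erase.2 ⟨hne, hmem σ⟩)).not_gt hσ
  have hR : 0 < ‖α‖ + 1 := by positivity
  obtain ⟨n, hn⟩ := exists_pow_lt_of_lt_one (div_pos hδ0 hR) hc1
  rw [lt_div_iff₀ hR] at hn
  obtain ⟨b, hb0, hb1, hb⟩ := exists_lt_pow_of_lt_one hp1 2
  obtain ⟨t, ht0, ht1, ht⟩ := exists_lt_pow_of_lt_one hb1 p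
  obtain ⟨K, hK, hKθ, x₀, hx₀, hαx₀⟩ := exists_frobeniusSurjective_approx hiso hd hp hp1 hp0 h hc0
    hc1 hc hR (by linarith : ‖α‖ ≤ ‖α‖ + 1) n ((one_lt_inv₀ ht0).2 ht1)
  have hαK : α ∈ K := by
    refine mem_of_fixes fun σ hσ => hδ σ (lt_of_le_of_lt ?_ hn)
    rw [show σ α - α = σ (α - x₀) - (α - x₀) by rw [map_sub, hσ _ hx₀]; ring]
    refine (norm_sub_le_max' _ _).trans ?_
    rw [hiso, max_self]
    exact hαx₀
  have hEK : E ≤ K := hEα ▸ adjoin_simple_le_iff.2 hαK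
  set q := ‖(p : A)‖ with hq
  have hqb : b⁻¹ * q < 1 := by
    rw [inv_mul_lt_iff₀ hb0]; nlinarith
  refine frobeniusSurjective_of_approx hd hp (c := b⁻¹ * q) hp1 hp0
    (le_mul_of_one_le_left hp0.le ((one_le_inv₀ hb0).2 hb1.le)) ?_ fun x hx hx1 => ?_
  · rw [mul_pow, inv_pow, inv_mul_lt_iff₀ (by positivity), pow_two q]
    gcongr
  obtain ⟨y, hy, hxy⟩ := hK x (hEK hx) hx1
  have hy1 := norm_le_one_of_norm_sub_pow_le hp hx1 (hxy.trans hp1.le)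
  obtain ⟨r, hr0, hr⟩ : ∃ r : ℝ, 0 ≤ r ∧ r ^ p = q :=
    ⟨q ^ ((p : ℝ)⁻¹), by positivity, Real.rpow_inv_natCast_pow hp0.le hp.ne_zero⟩
  obtain ⟨y', hy', hyy'⟩ := hKθ E y (le_sup_right (a := E) hy) r hr0 fun σ hσ => by
    have hσy : ‖σ y‖ ≤ 1 := by rwa [hiso]
    rw [← pow_le_pow_iff_left₀ (norm_nonneg _) hr0 hp.ne_zero, hr]
    refine (norm_sub_pow_le hp hy1 hσy).trans (max_le ?_ ?_)
    · rw [show σ y ^ p - y ^ p = (x - y ^ p) - σ (x - y ^ p) by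
        rw [map_sub, hσ x hx, map_pow]; ring]
      refine (norm_sub_le_max' _ _).trans ?_
      rwa [hiso, max_self]
    · exact mul_le_of_le_one_right hp0.le ((norm_sub_le_max' _ _).trans (max_le hσy hy1))
  have hpow : (r * t⁻¹) ^ p ≤ b⁻¹ * q := by
    rw [mul_pow, hr, inv_pow, mul_comm]
    gcongr
  have hyy1 : ‖y - y'‖ ≤ 1 := hyy'.trans
    ((pow_le_one_iff_of_nonneg (by positivity) hp.ne_zero).1 (hpow.trans hqb.le))
  have hy'1 : ‖y'‖ ≤ 1 := by
    rw [show y' = y - (y - y') by ring]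
    exact (norm_sub_le_max' _ _).trans (max_le hy1 hyy1)
  have hqle : q ≤ b⁻¹ * q := le_mul_of_one_le_left hp0.le ((one_le_inv₀ hb0).2 hb1.le)
  refine ⟨y', hy', ?_⟩
  rw [show x - y' ^ p = (x - y ^ p) + (y ^ p - y' ^ p) by ring]
  refine (IsUltrametricDist.norm_add_le_max _ _).trans (max_le (hxy.trans hqle) ?_)
  refine (norm_pow_sub_pow_le hp hy'1 hy1).trans (max_le ?_ ?_)
  · exact (pow_le_pow_left₀ (norm_nonneg _) hyy' p).trans hpow
  · exact (mul_le_of_le_one_right hp0.le hyy1).trans hqle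

end Descent

/-- If Frobenius is surjective modulo `p` on a complete densely normed field, then it is so on every
finite extension, for the spectral norm. -/
theorem exists_norm_sub_pow_le_of_finiteDimensional {F E : Type*} [NontriviallyNormedField F]
    [CompleteSpace F] [IsUltrametricDist F] [CharZero F] [Field E] [Algebra F E]
    [FiniteDimensional F E] {p : ℕ} (hp : p.Prime) (hp1 : ‖(p : F)‖ < 1)
    (hd : ∀ ε : ℝ, 0 < ε → ∃ x : F, 1 < ‖x‖ ∧ ‖x‖ < 1 + ε)
    (h : ∀ x : F, ‖x‖ ≤ 1 → ∃ y : F, ‖x - y ^ p‖ ≤ ‖(p : F)‖) (x : E)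
    (hx : spectralNorm F E x ≤ 1) : ∃ y : E, spectralNorm F E (x - y ^ p) ≤ ‖(p : F)‖ := by
  let A := AlgebraicClosure F
  let _ : NormedField A := spectralNorm.normedField F A
  have hnorm : ∀ z : A, ‖z‖ = spectralNorm F A z := fun _ => rfl
  have : IsUltrametricDist A :=
    IsUltrametricDist.isUltrametricDist_of_isNonarchimedean_norm isNonarchimedean_spectralNorm
  have hF : ∀ z : F, ‖algebraMap F A z‖ = ‖z‖ := spectralNorm_extends
  have hpA : ‖(p : A)‖ = ‖(p : F)‖ := by rw [← hF, map_natCast]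
  have hbot : FrobeniusSurjective p (⊥ : IntermediateField F A) := by
    intro z hz hz1
    obtain ⟨w, rfl⟩ := mem_bot.1 hz
    obtain ⟨y, hy⟩ := h w (by rwa [hF] at hz1)
    refine ⟨algebraMap F A y, (⊥ : IntermediateField F A).algebraMap_mem y, ?_⟩
    rwa [← map_pow, ← map_sub, hF, hpA]
  let φ : E →ₐ[F] A := IsAlgClosed.lift
  have hφ : ∀ z : E, ‖φ z‖ = spectralNorm F E z := fun z => by
    rw [hnorm, spectralNorm, spectralNorm, minpoly.algHom_eq φ φ.injective]
  have : FiniteDimensional F φ.fieldRange :=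
    (AlgEquiv.ofInjectiveField φ).toLinearEquiv.finiteDimensional
  have key := hbot.of_finiteDimensional (fun σ z => (spectralNorm_eq_of_equiv σ z).symm)
    (fun ε hε => by simpa only [hF] using hd ε hε) hp (by rwa [hpA])
    (by rw [hpA, norm_pos_iff]; exact_mod_cast hp.ne_zero) φ.fieldRange
  obtain ⟨_, ⟨y, rfl⟩, hy⟩ := key (φ x) ⟨x, rfl⟩ (by rwa [hφ])
  refine ⟨y, ?_⟩
  rw [← hpA, ← hφ, map_sub, map_pow]
  exact hy

end UltrametricField

namespace CompleteMulNorm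

variable {F : Type*} [Field F]

/-- The absolute value underlying a complete multiplicative norm. -/
def absoluteValue (ν : CompleteMulNorm F) : AbsoluteValue F ℝ where
  toFun := ν.nrm
  map_mul' := ν.mul
  nonneg' := ν.nonneg
  eq_zero' := ν.eq_zero_iff
  add_le' x y := (ν.nonarch x y).trans (max_le_add_of_nonneg (ν.nonneg x) (ν.nonneg y))

end CompleteMulNorm

/-- A finite extension of a perfectoid field, with its complete
multiplicative nonarchimedean norm extending that of the base isometrically,
is again a perfectoid field. -/
theorem finite_extension_of_perfectoid_isPerfectoid
    (p : ℕ) (hp : p.Prime) (F E : Type*) [Field F] [Field E]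
    [Algebra F E] [FiniteDimensional F E]
    (νF : CompleteMulNorm F) (νE : CompleteMulNorm E)
    (hisom : ∀ x : F, νE.nrm (algebraMap F E x) = νF.nrm x)
    (hF : νF.IsPerfectoid p) :
    νE.IsPerfectoid p := by
  obtain ⟨hchar, hp1, hd, hfrob⟩ := hF
  have hpE : νE.nrm (p : E) = νF.nrm (p : F) := by rw [← hisom, map_natCast]
  refine ⟨charZero_of_injective_algebraMap (algebraMap F E).injective, hpE ▸ hp1,
    fun ε hε => ?_, ?_⟩
  · obtain ⟨x, hx0, hx1, hx2⟩ := hd ε hε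
    exact ⟨algebraMap F E x, by simpa using hx0, by rwa [hisom], by rwa [hisom]⟩
  let nF : NontriviallyNormedField F :=
    { νF.absoluteValue.toNormedField with
      non_trivial := by
        obtain ⟨x, -, hx, -⟩ := hd 1 one_pos
        exact ⟨x, hx⟩ }
  have hnF : ∀ x : F, ‖x‖ = νF.nrm x := fun _ => rfl
  have : IsUltrametricDist F :=
    IsUltrametricDist.isUltrametricDist_of_isNonarchimedean_norm νF.nonarch
  have : CompleteSpace F := by
    refine Metric.complete_of_cauchySeq_tendsto fun u hu => ?_
    rw [Metric.cauchySeq_iff] at hu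
    obtain ⟨x, hx⟩ := νF.complete u fun ε hε => by
      simpa only [dist_eq_norm, hnF] using hu ε hε
    refine ⟨x, Metric.tendsto_atTop.2 fun ε hε => ?_⟩
    simpa only [dist_eq_norm, hnF] using hx ε hε
  have hspec : ∀ x : E, νE.nrm x = spectralNorm F E x :=
    spectralNorm_unique_field_norm_ext (f := νE.absoluteValue) hisom
  intro x hx
  rw [hspec] at hx
  obtain ⟨y, hy⟩ := UltrametricField.exists_norm_sub_pow_le_of_finiteDimensional hp hp1
    (fun ε hε => (hd ε hε).imp fun _ h => h.2) hfrob x hx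
  exact ⟨y, by rwa [hspec, hpE]⟩
end

section
/- Let F be a field of characteristic 0, complete with respect to a multiplicative nonarchimedean norm with ‖p‖ < 1, where p is a prime. Let E be a field equipped with a multiplicative nonarchimedean norm under which E is complete, together with a ring homomorphism F → E that is isometric and makes E a finite-dimensional F-vector space. If E is a perfectoid field, then F is a perfectoid field; that is, the norm on F is not discretely valued (for every ε > 0 there exists x ∈ F, x ≠ 0, with 1 < ‖x‖ < 1 + ε), and for every x ∈ F with ‖x‖ ≤ 1 there exists y ∈ F with ‖x − y^p‖ ≤ ‖p‖_F. -/
section Nonarchimedean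

variable {L : Type*} [Field L] {w : AbsoluteValue L ℝ}

/-- The closed unit ball of a nonarchimedean absolute value, as a subring. -/
def IsNonarchimedean.unitBall (hw : IsNonarchimedean w) : Subring L where
  carrier := {x | w x ≤ 1}
  mul_mem' {x y} hx hy := by
    simpa using mul_le_one₀ (show w x ≤ 1 from hx) (w.nonneg y) (show w y ≤ 1 from hy)
  one_mem' := by simp
  add_mem' {x y} hx hy := (hw x y).trans (max_le hx hy)
  zero_mem' := by simp
  neg_mem' {x} hx := by simpa using hx

theorem IsNonarchimedean.map_sub_le_max (hw : IsNonarchimedean w) (x y : L) :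
    w (x - y) ≤ max (w x) (w y) := by
  simpa [sub_eq_add_neg] using hw x (-y)

theorem IsNonarchimedean.map_add_pow_prime_sub_le (hw : IsNonarchimedean w) {p : ℕ}
    (hp : p.Prime) {a b : L} (ha : w a ≤ 1) (hb : w b ≤ 1) :
    w ((a + b) ^ p - a ^ p - b ^ p) ≤ w p * (w a * w b) := by
  obtain ⟨r, hr⟩ := exists_add_pow_prime_eq hp (⟨a, ha⟩ : hw.unitBall) ⟨b, hb⟩
  have hr' : (a + b) ^ p = a ^ p + b ^ p + p * a * b * r := by
    simpa using congrArg Subtype.val hr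
  have h1 : w r ≤ 1 := r.2
  rw [show (a + b) ^ p - a ^ p - b ^ p = p * (a * b) * r by rw [hr']; ring, map_mul, map_mul,
    map_mul]
  exact mul_le_of_le_one_right (by positivity) h1

theorem IsNonarchimedean.map_sum_pow_prime_sub_le (hw : IsNonarchimedean w) {p : ℕ}
    (hp : p.Prime) {ι : Type*} (s : Finset ι) {x : ι → L} (hx : ∀ i, w (x i) ≤ 1) :
    w ((∑ i ∈ s, x i) ^ p - ∑ i ∈ s, x i ^ p) ≤ w p := by
  classical
  induction s using Finset.induction_on with
  | empty => simp [hp.ne_zero]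
  | insert a s ha ih =>
    have hs : w (∑ i ∈ s, x i) ≤ 1 := hw.unitBall.sum_mem fun i _ => hx i
    rw [Finset.sum_insert ha, Finset.sum_insert ha,
      show (x a + ∑ i ∈ s, x i) ^ p - (x a ^ p + ∑ i ∈ s, x i ^ p) =
        ((x a + ∑ i ∈ s, x i) ^ p - x a ^ p - (∑ i ∈ s, x i) ^ p) +
        ((∑ i ∈ s, x i) ^ p - ∑ i ∈ s, x i ^ p) by ring]
    refine (hw _ _).trans (max_le ((hw.map_add_pow_prime_sub_le hp (hx a) hs).trans ?_) ih)
    exact mul_le_of_le_one_right (w.nonneg _) (mul_le_one₀ (hx a) (w.nonneg _) hs)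

/-- If `x` is a `p`-th power modulo `p`, it can be written as `y ^ p + p * z` with `y` and `z`
in the unit ball. -/
theorem IsNonarchimedean.exists_eq_pow_add_mul (hw : IsNonarchimedean w) {p : ℕ}
    (hp0 : p ≠ 0) (hpos : 0 < w p) (hp1 : w p < 1) {x y : L} (hx : w x ≤ 1)
    (hxy : w (x - y ^ p) ≤ w p) :
    ∃ z, w y ≤ 1 ∧ w z ≤ 1 ∧ x = y ^ p + p * z := by
  refine ⟨(x - y ^ p) / p, ?_, ?_, ?_⟩
  · have h : w (y ^ p) ≤ 1 := by
      have := hw.map_sub_le_max x (x - y ^ p)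
      rw [sub_sub_cancel] at this
      exact this.trans (max_le hx (hxy.trans hp1.le))
    rw [map_pow] at h
    exact (pow_le_one_iff_of_nonneg (w.nonneg _) hp0).1 h
  · rw [map_div₀]
    exact (div_le_one hpos).2 hxy
  · have : (p : L) ≠ 0 := w.pos_iff.1 hpos
    field_simp
    ring

end Nonarchimedean

section Frobenius

variable {E L : Type*} [Field E] [Field L] {v : AbsoluteValue E ℝ} {w : AbsoluteValue L ℝ}

/-- Distinct isometric embeddings of a field with surjective Frobenius modulo `p` are almost
as far apart as possible on the unit ball. -/
theorem exists_lt_map_sub_of_ne (hv : IsNonarchimedean v) (hw : IsNonarchimedean w) {p : ℕ}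
    (hp : p.Prime) (hpos : 0 < v p) (hp1 : v p < 1)
    (hfrob : ∀ x, v x ≤ 1 → ∃ y, v (x - y ^ p) ≤ v p) {σ τ : E →+* L}
    (hσ : ∀ x, w (σ x) = v x) (hτ : ∀ x, w (τ x) = v x) (hne : σ ≠ τ) {θ : ℝ} (hθ : θ < 1) :
    ∃ u, v u ≤ 1 ∧ θ < w (σ u - τ u) := by
  by_contra! hle
  have hθ0 : 0 ≤ θ := by simpa using hle 0 (by simp)
  have hwp : w p = v p := by simpa using hσ p
  set κ := max θ (v p) with hκ
  have hκ0 : 0 ≤ κ := hθ0.trans (le_max_left _ _)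
  have hκ1 : κ < 1 := max_lt hθ hp1
  have key : ∀ n : ℕ, ∀ u, v u ≤ 1 → w (σ u - τ u) ≤ κ ^ n := by
    intro n
    induction n with
    | zero => exact fun u hu => by simpa using (hle u hu).trans hθ.le
    | succ n ih =>
      intro u hu
      obtain ⟨y, hy⟩ := hfrob u hu
      obtain ⟨z, hy1, hz1, rfl⟩ := hv.exists_eq_pow_add_mul hp.ne_zero hpos hp1 hu hy
      set d := σ y - τ y with hd
      have hdn : w d ≤ κ ^ n := ih y hy1
      have hdκ : w d ≤ κ := (hle y hy1).trans (le_max_left _ _)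
      have hd1 : w d ≤ 1 := hdκ.trans hκ1.le
      have hsplit : σ (y ^ p + p * z) - τ (y ^ p + p * z) =
          ((d + τ y) ^ p - d ^ p - τ y ^ p) + (d ^ p + p * (σ z - τ z)) := by
        simp only [map_add, map_mul, map_pow, map_natCast, hd]
        ring
      have hprod : κ * κ ^ n = κ ^ (n + 1) := (pow_succ' κ n).symm
      rw [hsplit]
      refine (hw _ _).trans (max_le ?_ ((hw _ _).trans (max_le ?_ ?_)))
      · refine (hw.map_add_pow_prime_sub_le hp hd1 ((hτ y).trans_le hy1)).trans ?_
        rw [hwp, ← hprod]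
        gcongr
        · exact le_max_right _ _
        · exact (mul_le_of_le_one_right (w.nonneg _) ((hτ y).trans_le hy1)).trans hdn
      · rw [map_pow, ← hprod]
        calc w d ^ p ≤ w d ^ 2 := pow_le_pow_of_le_one (w.nonneg _) hd1 hp.two_le
          _ = w d * w d := sq _
          _ ≤ κ * κ ^ n := by gcongr
      · rw [map_mul, hwp, ← hprod]
        gcongr
        · exact le_max_right _ _
        · exact ih z hz1
  have hball : ∀ u, v u ≤ 1 → σ u = τ u := fun u hu => by
    have h0 : w (σ u - τ u) ≤ 0 :=
      ge_of_tendsto' (tendsto_pow_atTop_nhds_zero_of_lt_one hκ0 hκ1) fun n => key n u hu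
    exact sub_eq_zero.1 (w.nonpos_iff.1 h0)
  refine hne (RingHom.ext fun u => ?_)
  rcases le_total (v u) 1 with hu | hu
  · exact hball u hu
  · have := hball u⁻¹ (by rw [map_inv₀]; exact inv_le_one_of_one_le₀ hu)
    simpa using this

theorem exists_le_pow_of_lt_one (N : ℕ) {θ : ℝ} (hθ : θ < 1) :
    ∃ η : ℝ, 0 < η ∧ η < 1 ∧ θ ≤ η ^ N := by
  have hlim : Filter.Tendsto (fun x : ℝ => x ^ N) (nhdsWithin 1 (Set.Iio 1)) (nhds 1) := by
    have : ContinuousAt (fun x : ℝ => x ^ N) 1 := by fun_prop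
    simpa [ContinuousAt] using this.mono_left nhdsWithin_le_nhds
  have h0 : ∀ᶠ x : ℝ in nhdsWithin 1 (Set.Iio 1), 0 < x :=
    nhdsWithin_le_nhds (lt_mem_nhds one_pos)
  obtain ⟨η, ⟨h1, h2⟩, h3⟩ :=
    ((h0.and self_mem_nhdsWithin).and (hlim.eventually (lt_mem_nhds hθ))).exists
  exact ⟨η, h1, h2, h3.le⟩

/-- The trace from a finite separable extension with surjective Frobenius modulo `p` is almost
surjective on unit balls. -/
theorem exists_le_map_trace {F : Type*} [Field F] [Algebra F E] [FiniteDimensional F E]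
    [Algebra.IsSeparable F E] [Algebra F L] [IsAlgClosed L]
    (hv : IsNonarchimedean v) (hw : IsNonarchimedean w) {p : ℕ}
    (hp : p.Prime) (hpos : 0 < v p) (hp1 : v p < 1)
    (hfrob : ∀ x, v x ≤ 1 → ∃ y, v (x - y ^ p) ≤ v p)
    (hiso : ∀ (τ : E →ₐ[F] L) x, w (τ x) = v x) {θ : ℝ} (hθ : θ < 1) :
    ∃ t, v t ≤ 1 ∧ θ ≤ w (algebraMap F L (Algebra.trace F E t)) := by
  classical
  let ι : E →ₐ[F] L := IsAlgClosed.lift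
  set s : Finset (E →ₐ[F] L) := Finset.univ.erase ι with hs
  obtain ⟨η, hη0, hη1, hη⟩ := exists_le_pow_of_lt_one s.card hθ
  have hex : ∀ σ : E →ₐ[F] L, ∃ u, v u ≤ 1 ∧ (σ ∈ s → η ≤ w (σ u - ι u)) := by
    intro σ
    by_cases hσ : σ ∈ s
    · have hne : (σ : E →+* L) ≠ ι := fun h =>
        Finset.ne_of_mem_erase hσ (AlgHom.coe_ringHom_injective h)
      obtain ⟨u, hu, hlt⟩ :=
        exists_lt_map_sub_of_ne hv hw hp hpos hp1 hfrob (hiso σ) (hiso ι) hne hη1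
      exact ⟨u, hu, fun _ => hlt.le⟩
    · exact ⟨0, by simp, fun h => absurd h hσ⟩
  choose u hu hlt using hex
  have hsum : ∏ σ ∈ s, (σ (u σ) - ι (u σ)) = ∑ t ∈ s.powerset,
      ((-1) ^ t.card * ∏ σ ∈ s \ t, σ (u σ)) *
        algebraMap F L (Algebra.trace F E (∏ σ ∈ t, u σ)) := by
    calc ∏ σ ∈ s, (σ (u σ) - ι (u σ))
        = ∑ τ : E →ₐ[F] L, ∏ σ ∈ s, (σ (u σ) - τ (u σ)) := by
          symm
          refine Finset.sum_eq_single_of_mem ι (Finset.mem_univ _) fun τ _ hτ => ?_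
          exact Finset.prod_eq_zero (Finset.mem_erase.2 ⟨hτ, Finset.mem_univ τ⟩) (sub_self _)
      _ = _ := by
          simp_rw [Finset.prod_sub, trace_eq_sum_embeddings L, Finset.mul_sum, map_prod]
          exact Finset.sum_comm
  obtain ⟨t, -, ht⟩ := hw.finset_image_add_of_nonempty
    (fun t => ((-1) ^ t.card * ∏ σ ∈ s \ t, σ (u σ)) *
        algebraMap F L (Algebra.trace F E (∏ σ ∈ t, u σ))) s.powerset_nonempty
  refine ⟨∏ σ ∈ t, u σ, hv.unitBall.prod_mem fun σ _ => hu σ, ?_⟩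
  calc θ ≤ η ^ s.card := hη
    _ = ∏ σ ∈ s, η := by simp
    _ ≤ ∏ σ ∈ s, w (σ (u σ) - ι (u σ)) :=
        Finset.prod_le_prod (fun _ _ => hη0.le) fun σ hσ => hlt σ hσ
    _ = w (∏ σ ∈ s, (σ (u σ) - ι (u σ))) := (map_prod w _ _).symm
    _ ≤ _ := hsum ▸ ht
    _ ≤ _ := by
        rw [map_mul]
        refine mul_le_of_le_one_left (w.nonneg _) ?_
        exact hw.unitBall.mul_mem (hw.unitBall.pow_mem (by simp [IsNonarchimedean.unitBall]) _)
          (hw.unitBall.prod_mem fun σ _ => (hiso σ _).trans_le (hu σ))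

/-- Frobenius is almost surjective modulo `p` on the base of a finite separable extension whose
Frobenius is surjective modulo `p`. -/
theorem exists_map_sub_pow_mul_le {F : Type*} [Field F] {vF : AbsoluteValue F ℝ}
    [Algebra F E] [FiniteDimensional F E]
    [Algebra.IsSeparable F E] [Algebra F L] [IsAlgClosed L]
    (hv : IsNonarchimedean v) (hw : IsNonarchimedean w) {p : ℕ}
    (hp : p.Prime) (hpos : 0 < v p) (hp1 : v p < 1)
    (hfrob : ∀ x, v x ≤ 1 → ∃ y, v (x - y ^ p) ≤ v p)
    (hiso : ∀ (τ : E →ₐ[F] L) x, w (τ x) = v x)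
    (hisoF : ∀ x, w (algebraMap F L x) = vF x) {θ : ℝ} (hθ : θ < 1) {x : F} (hx : vF x ≤ 1) :
    ∃ y, vF (x - y ^ p) * θ ≤ vF p := by
  obtain ⟨η, hη0, hη1, hη⟩ := exists_le_pow_of_lt_one p hθ
  obtain ⟨t, ht1, htη⟩ := exists_le_map_trace (F := F) (L := L) hv hw hp hpos hp1 hfrob hiso hη1
  let ι : E →ₐ[F] L := IsAlgClosed.lift
  set c := Algebra.trace F E t with hc
  rw [hisoF] at htη
  have hcpos : 0 < vF c := hη0.trans_le htη
  have hc0 : c ≠ 0 := vF.pos_iff.1 hcpos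
  have hxE : v (algebraMap F E x) ≤ 1 := by
    rw [← hiso ι, ι.commutes, hisoF]
    exact hx
  obtain ⟨y, hy⟩ := hfrob _ hxE
  obtain ⟨z, hy1, hz1, hxyz⟩ := hv.exists_eq_pow_add_mul hp.ne_zero hpos hp1 hxE hy
  have hty : v (t * y) ≤ 1 := hv.unitBall.mul_mem ht1 hy1
  have htr : ∀ e : E, algebraMap F L (Algebra.trace F E e) = ∑ σ : E →ₐ[F] L, σ e :=
    fun e => trace_eq_sum_embeddings L
  set d := Algebra.trace F E (t * y) with hd
  have hmain : vF (x * c ^ p - d ^ p) ≤ vF p := by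
    rw [← hisoF, ← hisoF, map_natCast]
    have hsplit : algebraMap F L (x * c ^ p - d ^ p) =
        algebraMap F L x * ((∑ σ : E →ₐ[F] L, σ t) ^ p - ∑ σ : E →ₐ[F] L, σ t ^ p) +
        (p * (∑ σ : E →ₐ[F] L, σ t ^ p * σ z) -
          ((∑ σ : E →ₐ[F] L, σ (t * y)) ^ p - ∑ σ : E →ₐ[F] L, σ (t * y) ^ p)) := by
      have hpt : ∀ σ : E →ₐ[F] L, σ (t * y) ^ p =
          algebraMap F L x * σ t ^ p - p * (σ t ^ p * σ z) := by
        intro σ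
        have h := congrArg σ hxyz
        simp only [AlgHom.commutes, map_add, map_mul, map_pow, map_natCast] at h
        rw [h, map_mul]
        ring
      simp_rw [hpt]
      rw [Finset.sum_sub_distrib, ← Finset.mul_sum, ← Finset.mul_sum, ← htr, ← htr]
      simp only [map_sub, map_mul, map_pow, ← hc, ← hd]
      ring
    rw [hsplit]
    refine (hw _ _).trans (max_le ?_ ((hw.map_sub_le_max _ _).trans (max_le ?_ ?_)))
    · rw [map_mul]
      exact (mul_le_of_le_one_left (w.nonneg _) ((hisoF x).trans_le hx)).trans
        (hw.map_sum_pow_prime_sub_le hp _ fun σ => (hiso σ t).trans_le ht1)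
    · rw [map_mul]
      refine mul_le_of_le_one_right (w.nonneg _) (hw.unitBall.sum_mem fun σ _ => ?_)
      exact hw.unitBall.mul_mem (hw.unitBall.pow_mem ((hiso σ t).trans_le ht1) _)
        ((hiso σ z).trans_le hz1)
    · exact hw.map_sum_pow_prime_sub_le hp _ fun σ => (hiso σ _).trans_le hty
  refine ⟨d / c, ?_⟩
  calc vF (x - (d / c) ^ p) * θ ≤ vF (x - (d / c) ^ p) * vF c ^ p := by
        gcongr
        exact hη.trans (by gcongr)
    _ = vF (x * c ^ p - d ^ p) := by
        rw [← map_pow, ← map_mul]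
        rw [sub_mul, div_pow, div_mul_cancel₀ _ (pow_ne_zero p hc0)]
    _ ≤ vF p := hmain

/-- Almost surjectivity of Frobenius modulo `p` implies surjectivity when the norm is not
discretely valued. -/
theorem exists_map_sub_pow_le_of_almost {v : AbsoluteValue E ℝ} (hv : IsNonarchimedean v)
    {p : ℕ} (hp : p.Prime) (hpos : 0 < v p) (hp1 : v p < 1)
    (hdense : ∀ ε : ℝ, 0 < ε → ∃ x, x ≠ 0 ∧ 1 < v x ∧ v x < 1 + ε)
    (hfrob : ∀ θ < (1 : ℝ), ∀ x, v x ≤ 1 → ∃ y, v (x - y ^ p) * θ ≤ v p)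
    {x : E} (hx : v x ≤ 1) : ∃ y, v (x - y ^ p) ≤ v p := by
  obtain ⟨η, hη0, hη1, hη⟩ := exists_le_pow_of_lt_one (p + 1) hp1
  obtain ⟨g, hg0, hg1, hgη⟩ := hdense (η⁻¹ - 1) (by linarith [(one_lt_inv₀ hη0).2 hη1])
  have hs1 : v g⁻¹ < 1 := by rw [map_inv₀]; exact inv_lt_one_of_one_lt₀ hg1
  have hsη : η < v g⁻¹ := by
    rw [map_inv₀, lt_inv_comm₀ hη0 (by linarith)]
    linarith
  set s := g⁻¹ with hs
  have hs0 : 0 < v s := hη0.trans hsη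
  have hsp : v p < v s ^ (p + 1) := hη.trans_lt (pow_lt_pow_left₀ hsη hη0.le (by omega))
  have hsp0 : 0 < v s ^ p := by positivity
  have hspp : v s ^ p ≤ v s := by
    simpa using pow_le_pow_of_le_one hs0.le hs1.le hp.one_le
  obtain ⟨y, hy⟩ := hfrob (v s) hs1 x hx
  have hr : v (x - y ^ p) ≤ v s ^ p := by
    by_contra! h
    have := mul_lt_mul_of_pos_right h hs0
    rw [← pow_succ] at this
    linarith
  have hr1 : v ((x - y ^ p) / s ^ p) ≤ 1 := by
    rw [map_div₀, map_pow]
    exact (div_le_one hsp0).2 hr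
  obtain ⟨z, hz⟩ := hfrob (v s) hs1 _ hr1
  have hy1 : v y ≤ 1 := by
    have h := hv.map_sub_le_max x (x - y ^ p)
    rw [sub_sub_cancel, map_pow] at h
    exact (pow_le_one_iff_of_nonneg (v.nonneg _) hp.ne_zero).1
      (h.trans (max_le hx (hr.trans (hspp.trans hs1.le))))
  have hs0' : s ≠ 0 := v.pos_iff.1 hs0
  have hq : v (s ^ p * ((x - y ^ p) / s ^ p - z ^ p)) ≤ v p := by
    rw [map_mul, map_pow, mul_comm]
    exact (mul_le_mul_of_nonneg_left hspp (v.nonneg _)).trans hz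
  have hq' : s ^ p * ((x - y ^ p) / s ^ p - z ^ p) = x - y ^ p - (s * z) ^ p := by
    rw [mul_pow]
    field_simp
  rw [hq'] at hq
  have hsz1 : v (s * z) ≤ 1 := by
    have h := hv.map_sub_le_max (x - y ^ p) (x - y ^ p - (s * z) ^ p)
    rw [sub_sub_cancel, map_pow] at h
    exact (pow_le_one_iff_of_nonneg (v.nonneg _) hp.ne_zero).1
      (h.trans (max_le (hr.trans (hspp.trans hs1.le)) (hq.trans hp1.le)))
  refine ⟨y + s * z, ?_⟩
  rw [show x - (y + s * z) ^ p = (x - y ^ p - (s * z) ^ p) -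
    ((y + s * z) ^ p - y ^ p - (s * z) ^ p) by ring]
  refine (hv.map_sub_le_max _ _).trans (max_le hq ?_)
  exact (hv.map_add_pow_prime_sub_le hp hy1 hsz1).trans
    (mul_le_of_le_one_right (v.nonneg _) (mul_le_one₀ hy1 (v.nonneg _) hsz1))

end Frobenius

section ValueGroup

variable {F E : Type*} [Field F] [Field E] [Algebra F E] [FiniteDimensional F E]
  {vF : AbsoluteValue F ℝ} {v : AbsoluteValue E ℝ}

/-- In a finite extension, some bounded positive power of the absolute value of any element is
the absolute value of an element of the base. -/
theorem exists_pow_eq_map_of_finiteDimensional (hv : IsNonarchimedean v)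
    (hiso : ∀ x, v (algebraMap F E x) = vF x) {e : E} (he : e ≠ 0) :
    ∃ (k : ℕ) (x : F), 0 < k ∧ k ≤ Module.finrank F E ∧ vF x = v e ^ k := by
  have hdep : ¬ LinearIndependent F (fun i : Fin (Module.finrank F E + 1) => e ^ (i : ℕ)) :=
    fun h => by simpa using h.fintype_card_le_finrank
  obtain ⟨a, ha, i₀, hi₀⟩ := Fintype.not_linearIndependent_iff.1 hdep
  have hpos : 0 < v e := v.pos he
  have hterm : ∀ i : Fin (Module.finrank F E + 1),
      v (a i • e ^ (i : ℕ)) = vF (a i) * v e ^ (i : ℕ) :=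
    fun i => by rw [Algebra.smul_def, map_mul, hiso, map_pow]
  obtain ⟨i, -, hmax⟩ := Finset.exists_max_image Finset.univ
    (fun i => v (a i • e ^ (i : ℕ))) ⟨i₀, Finset.mem_univ _⟩
  have hi : 0 < v (a i • e ^ (i : ℕ)) := by
    refine lt_of_lt_of_le ?_ (hmax i₀ (Finset.mem_univ _))
    exact v.pos (smul_ne_zero hi₀ (pow_ne_zero _ he))
  obtain ⟨j, hji, hj⟩ : ∃ j ≠ i, v (a j • e ^ (j : ℕ)) = v (a i • e ^ (i : ℕ)) := by
    by_contra! h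
    have hsum := hv.apply_sum_eq_of_lt (fun x => (v.map_neg x).symm) (Finset.mem_univ i)
      fun j hj hji => lt_of_le_of_ne (hmax j hj) (h j hji)
    rw [ha, map_zero] at hsum
    exact hi.ne hsum
  have main : ∀ i j : Fin (Module.finrank F E + 1), i < j → 0 < v (a j • e ^ (j : ℕ)) →
      v (a j • e ^ (j : ℕ)) = v (a i • e ^ (i : ℕ)) →
      ∃ (k : ℕ) (x : F), 0 < k ∧ k ≤ Module.finrank F E ∧ vF x = v e ^ k := by
    intro i j hij hj0 hj
    have hlt : (i : ℕ) < j := hij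
    refine ⟨j - i, a i / a j, by omega, by omega, ?_⟩
    rw [hterm] at hj0
    have haj : vF (a j) ≠ 0 := left_ne_zero_of_mul hj0.ne'
    rw [hterm, hterm, ← Nat.sub_add_cancel hlt.le, pow_add, ← mul_assoc] at hj
    rw [map_div₀, ← mul_right_cancel₀ (pow_pos hpos (i : ℕ)).ne' hj]
    field_simp
  rcases lt_or_gt_of_ne hji with h | h
  · exact main j i h hi hj.symm
  · exact main i j h (hj ▸ hi) hj

/-- A nonarchimedean absolute value that is not discretely valued on a finite extension is not
discretely valued on the base. -/
theorem exists_one_lt_map_lt_of_finiteDimensional (hv : IsNonarchimedean v)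
    (hiso : ∀ x, v (algebraMap F E x) = vF x)
    (hdense : ∀ ε : ℝ, 0 < ε → ∃ x, x ≠ 0 ∧ 1 < v x ∧ v x < 1 + ε) {ε : ℝ} (hε : 0 < ε) :
    ∃ x, x ≠ 0 ∧ 1 < vF x ∧ vF x < 1 + ε := by
  obtain ⟨η, hη0, hη1, hη⟩ :=
    exists_le_pow_of_lt_one (Module.finrank F E) (inv_lt_one_of_one_lt₀ (lt_add_of_pos_right 1 hε))
  obtain ⟨e, he, h1, h2⟩ := hdense (η⁻¹ - 1) (by linarith [(one_lt_inv₀ hη0).2 hη1])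
  rw [add_sub_cancel] at h2
  obtain ⟨k, x, hk, hkn, hx⟩ := exists_pow_eq_map_of_finiteDimensional hv hiso he
  have hx1 : 1 < vF x := hx ▸ one_lt_pow₀ h1 hk.ne'
  refine ⟨x, vF.pos_iff.1 (one_pos.trans hx1), hx1, ?_⟩
  calc vF x = v e ^ k := hx
    _ < η⁻¹ ^ k := pow_lt_pow_left₀ h2 (v.nonneg e) hk.ne'
    _ ≤ η⁻¹ ^ Module.finrank F E := pow_le_pow_right₀ (one_lt_inv₀ hη0 |>.2 hη1).le hkn
    _ ≤ 1 + ε := by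
      rw [inv_pow]
      exact inv_le_of_inv_le₀ (by linarith) hη

end ValueGroup

namespace CompleteMulNorm

variable {F E : Type*} [Field F] [Field E]

/-- The absolute value underlying a complete multiplicative nonarchimedean norm. -/
def absVal (ν : CompleteMulNorm F) : AbsoluteValue F ℝ where
  toFun := ν.nrm
  map_mul' := ν.mul
  nonneg' := ν.nonneg
  eq_zero' := ν.eq_zero_iff
  add_le' x y := (ν.nonarch x y).trans (max_le_add_of_nonneg (ν.nonneg x) (ν.nonneg y))

theorem isNonarchimedean_absVal (ν : CompleteMulNorm F) : IsNonarchimedean ν.absVal :=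
  ν.nonarch

/-- A nontrivial complete nonarchimedean norm extends to any algebraic extension `L`, and every
embedding into `L` of an algebraic extension with compatible norm is isometric. -/
theorem exists_extension [Algebra F E] [Algebra.IsAlgebraic F E] (νF : CompleteMulNorm F)
    (νE : CompleteMulNorm E) (hnontriv : ∃ x, x ≠ 0 ∧ νF.nrm x < 1)
    (hisom : ∀ x, νE.nrm (algebraMap F E x) = νF.nrm x)
    (L : Type*) [Field L] [Algebra F L] [Algebra.IsAlgebraic F L] :
    ∃ w : AbsoluteValue L ℝ, IsNonarchimedean w ∧ (∀ x, w (algebraMap F L x) = νF.absVal x) ∧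
      ∀ (τ : E →ₐ[F] L) x, w (τ x) = νE.absVal x := by
  let : NormedField F := νF.absVal.toNormedField
  have hnorm : ∀ x : F, ‖x‖ = νF.nrm x := fun _ => rfl
  let : NontriviallyNormedField F := NontriviallyNormedField.ofNormNeOne <| by
    obtain ⟨x, hx, hx1⟩ := hnontriv
    exact ⟨x, hx, hx1.ne⟩
  have : IsUltrametricDist F :=
    IsUltrametricDist.isUltrametricDist_of_isNonarchimedean_norm νF.nonarch
  have : CompleteSpace F := by
    refine Metric.complete_of_cauchySeq_tendsto fun u hu => ?_
    obtain ⟨x, hx⟩ := νF.complete u fun ε hε => by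
      simpa only [dist_eq_norm, hnorm] using Metric.cauchySeq_iff.1 hu ε hε
    refine ⟨x, Metric.tendsto_atTop.2 fun ε hε => ?_⟩
    simpa only [dist_eq_norm, hnorm] using hx ε hε
  let w : AbsoluteValue L ℝ :=
    { toFun := spectralNorm F L
      map_mul' := fun x y => spectralAlgNorm_mul x y
      nonneg' := fun x => spectralNorm_nonneg x
      eq_zero' := fun x => map_eq_zero_iff_eq_zero (spectralMulAlgNorm F L)
      add_le' := fun x y => map_add_le_add (spectralAlgNorm F L) x y }
  refine ⟨w, isNonarchimedean_spectralNorm (K := F) (L := L), fun x => ?_, fun τ x => ?_⟩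
  · exact spectralNorm_extends (K := F) (L := L) x
  · rw [spectralNorm_unique_field_norm_ext (K := F) (f := νE.absVal) hisom x]
    change spectralNorm F L (τ x) = spectralNorm F E x
    simp only [spectralNorm, minpoly.algHom_eq τ τ.injective]

end CompleteMulNorm

/-- If a complete multiplicatively normed field `F` of characteristic `0`
with `‖p‖ < 1` admits a finite extension `E` (with isometric structure map) that is a
perfectoid field, then `F` itself is a perfectoid field. -/
theorem perfectoid_descends_along_finite_extension
    (p : ℕ) (hp : p.Prime) (F E : Type*) [Field F] [CharZero F] [Field E]
    [Algebra F E] [FiniteDimensional F E]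
    (νF : CompleteMulNorm F) (νE : CompleteMulNorm E)
    (hpF : νF.nrm (p : F) < 1)
    (hisom : ∀ x : F, νE.nrm (algebraMap F E x) = νF.nrm x)
    (hE : νE.IsPerfectoid p) :
    νF.IsPerfectoid p := by
  have hp0 : (p : F) ≠ 0 := Nat.cast_ne_zero.2 hp.ne_zero
  have : CharZero E := hE.1
  obtain ⟨-, hp1, hdense, hfrob⟩ := hE
  obtain ⟨w, hw, hwF, hwE⟩ := νF.exists_extension νE ⟨p, hp0, hpF⟩ hisom (AlgebraicClosure F)
  have hdenseF : ∀ ε : ℝ, 0 < ε → ∃ x : F, x ≠ 0 ∧ 1 < νF.absVal x ∧ νF.absVal x < 1 + ε :=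
    fun ε hε => exists_one_lt_map_lt_of_finiteDimensional νE.isNonarchimedean_absVal hisom
      hdense hε
  have hposE : 0 < νE.absVal p := νE.absVal.pos (Nat.cast_ne_zero.2 hp.ne_zero)
  refine ⟨inferInstance, hpF, hdenseF, fun x hx => ?_⟩
  exact exists_map_sub_pow_le_of_almost νF.isNonarchimedean_absVal hp (νF.absVal.pos hp0) hpF
    hdenseF (fun θ hθ x hx => exists_map_sub_pow_mul_le νE.isNonarchimedean_absVal hw hp hposE
      hp1 hfrob hwE hwF hθ hx) hx
end
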